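/- arXiv:1510.08781 — 3 statements merged into one kernel-verified Lean document; each statement's English description precedes it below -/
import Mathlib

section
/- For all infinite sets x, y of natural numbers: the measures μ^x and μ^y are equivalent (mutually absolutely continuous) if and only if ρ(x,y) < ∞, and μ^x and μ^y are mutually singular if and only if ρ(x,y) = ∞. -/
open MeasureTheory Filter Set
open scoped ENNReal

noncomputable section

/-- `fEnum x` is the increasing enumeration `f_x : ω → ω` of the set `x ∈ [ω]^ω`. -/
def fEnum (x : Set ℕ) : ℕ → ℕ := Nat.nth (· ∈ x)

/-- The sequence `α^x ∈ [1/4,3/4]^ω` attached to `x ∈ [ω]^ω`: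
`α^x_n = 1/4 + 1/(2·√(f_x⁻¹(n)+1))` if `n ∈ x` and `α^x_n = 1/4` otherwise
(for `n ∈ x`, `f_x⁻¹(n)` is the number of elements of `x` below `n`). -/
noncomputable def alphaSeq (x : Set ℕ) (n : ℕ) : ℝ :=
  haveI := Classical.decPred (· ∈ x)
  if n ∈ x then 1/4 + 1/(2 * Real.sqrt ((Nat.count (· ∈ x) n : ℝ) + 1)) else 1/4

/-- `ρ(x,y) = Σ_n (α^x_n - α^y_n)² ∈ [0,∞]`. -/
noncomputable def rho (x y : Set ℕ) : ℝ≥0∞ :=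
  ∑' n : ℕ, ENNReal.ofReal ((alphaSeq x n - alphaSeq y n)^2)

/-- `F = {g ∈ [ω]^ω : ρ(g,ω) < ∞}`. -/
def Fset : Set (Set ℕ) := {g | g.Infinite ∧ rho g Set.univ < ⊤}

/-- The monoid operation `x · y = (f_y ∘ f_x)[ω]`. -/
def dotOp (x y : Set ℕ) : Set ℕ := Set.range (fEnum y ∘ fEnum x)

/-- `IsKakutaniProduct x μ` says that `μ` is the product measure
`μ^x = ∏_n (α^x_n δ_0 + (1 - α^x_n) δ_1)` on Cantor space `2^ω = ℕ → Bool`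
(identifying `0` with `false` and `1` with `true`), i.e. `μ` is the Borel
probability measure giving each finite cylinder the corresponding product of
the coordinate weights.  These conditions determine `μ^x` uniquely. -/
def IsKakutaniProduct (x : Set ℕ) (μ : Measure (ℕ → Bool)) : Prop :=
  IsProbabilityMeasure μ ∧
    ∀ (s : Finset ℕ) (f : ℕ → Bool),
      μ {g | ∀ n ∈ s, g n = f n} =
        ∏ n ∈ s, (if f n = false then ENNReal.ofReal (alphaSeq x n)
                  else ENNReal.ofReal (1 - alphaSeq x n))

/-- The subset of `ℕ` coded by a point of Cantor space. -/
def toSet (f : ℕ → Bool) : Set ℕ := {n | f n = true}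

/-- The weight given to `b` by `p δ_false + (1 - p) δ_true`. -/
def bernoulliWeight (p : ℝ) (b : Bool) : ℝ := if b = false then p else 1 - p

lemma bernoulliWeight_pos {p : ℝ} (h0 : 0 < p) (h1 : p < 1) (b : Bool) :
    0 < bernoulliWeight p b := by
  cases b <;> simp [bernoulliWeight, h0, h1]

/-- The restriction of a point of Cantor space to its first `N` coordinates. -/
def initSeg (N : ℕ) (g : ℕ → Bool) : Fin N → Bool := fun i => g i

lemma measurable_initSeg (N : ℕ) : Measurable (initSeg N) :=
  measurable_pi_lambda _ fun i => measurable_pi_apply (i : ℕ)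

/-- `μ` has the cylinder probabilities of the product of the measures
`p n δ_false + (1 - p n) δ_true`. -/
def HasBernoulliCylinders (p : ℕ → ℝ) (μ : Measure (ℕ → Bool)) : Prop :=
  ∀ (N : ℕ) (t : Fin N → Bool),
    μ.real (initSeg N ⁻¹' {t}) = ∏ i : Fin N, bernoulliWeight (p i) (t i)

lemma sum_prod_bool {N : ℕ} (F : Fin N → Bool → ℝ) :
    ∑ t : Fin N → Bool, ∏ i, F i (t i) = ∏ i, (F i false + F i true) := by
  simp_rw [add_comm (F _ false), ← Fintype.sum_bool]
  exact (Fintype.prod_sum F).symm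

lemma hellinger_affinity_le {p q : ℝ} (hp0 : 0 ≤ p) (hp1 : p ≤ 1) (hq0 : 0 ≤ q) (hq1 : q ≤ 1) :
    √(p * q) + √((1 - p) * (1 - q)) ≤ 1 - (p - q) ^ 2 / 8 := by
  rw [Real.sqrt_mul hp0, Real.sqrt_mul (by linarith)]
  have a := Real.sq_sqrt hp0
  have b := Real.sq_sqrt hq0
  have c := Real.sq_sqrt (show 0 ≤ 1 - p by linarith)
  have d := Real.sq_sqrt (show 0 ≤ 1 - q by linarith)
  have ha : √p ≤ 1 := Real.sqrt_le_one.2 hp1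
  have hb : √q ≤ 1 := Real.sqrt_le_one.2 hq1
  have ha0 := Real.sqrt_nonneg p
  have hb0 := Real.sqrt_nonneg q
  have key : (p - q) ^ 2 ≤ 4 * (√p - √q) ^ 2 := by
    have h : (p - q) ^ 2 = (√p + √q) ^ 2 * (√p - √q) ^ 2 := by
      rw [← mul_pow, ← sq_sub_sq, a, b]
    rw [h]
    gcongr
    nlinarith
  nlinarith [sq_nonneg (√(1 - p) - √(1 - q))]

lemma mutuallySingular_of_unbounded {p q : ℕ → ℝ} {μ ν : Measure (ℕ → Bool)}
    [IsFiniteMeasure μ] [IsFiniteMeasure ν]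
    (hp : ∀ n, p n ∈ Ioo (0 : ℝ) 1) (hq : ∀ n, q n ∈ Ioo (0 : ℝ) 1)
    (hμ : HasBernoulliCylinders p μ) (hν : HasBernoulliCylinders q ν)
    (h : ∀ K : ℝ, ∃ N, K ≤ ∑ n ∈ Finset.range N, (p n - q n) ^ 2) :
    μ ⟂ₘ ν := by
  rw [Measure.mutuallySingular_iff_disjoint, disjoint_iff_inf_le]
  set ξ := μ ⊓ ν
  have hξμ : ξ ≤ μ := inf_le_left
  have hξν : ξ ≤ ν := inf_le_right
  have : IsFiniteMeasure ξ := isFiniteMeasure_of_le μ hξμ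
  have bound : ∀ N, ξ.real univ ≤
      Real.exp (-(∑ n ∈ Finset.range N, (p n - q n) ^ 2) / 8) := by
    intro N
    have hsum : ∑ t, ξ.real (initSeg N ⁻¹' {t}) = ξ.real univ := by
      rw [sum_measureReal_preimage_singleton]
      · simp
      · exact fun t _ => measurable_initSeg N (measurableSet_singleton t)
    rw [← hsum]
    calc ∑ t, ξ.real (initSeg N ⁻¹' {t})
        ≤ ∑ t : Fin N → Bool, ∏ i : Fin N,
            √(bernoulliWeight (p i) (t i) * bernoulliWeight (q i) (t i)) := by
          gcongr with t
          have h1 : ξ.real (initSeg N ⁻¹' {t}) ≤ _ :=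
            (ENNReal.toReal_mono (measure_ne_top _ _) (hξμ _)).trans_eq (hμ N t)
          have h2 : ξ.real (initSeg N ⁻¹' {t}) ≤ _ :=
            (ENNReal.toReal_mono (measure_ne_top _ _) (hξν _)).trans_eq (hν N t)
          rw [← Real.sqrt_prod Finset.univ (x := fun i : Fin N =>
              bernoulliWeight (p i) (t i) * bernoulliWeight (q i) (t i)) fun i _ => (mul_pos
            (bernoulliWeight_pos (hp i).1 (hp i).2 _)
            (bernoulliWeight_pos (hq i).1 (hq i).2 _)).le, Finset.prod_mul_distrib]
          apply Real.le_sqrt_of_sq_le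
          rw [sq]
          exact mul_le_mul h1 h2 measureReal_nonneg (measureReal_nonneg.trans h1)
      _ = ∏ i : Fin N, (√(p i * q i) + √((1 - p i) * (1 - q i))) := by
          rw [sum_prod_bool fun i b =>
            √(bernoulliWeight (p i) b * bernoulliWeight (q i) b)]
          simp [bernoulliWeight]
      _ ≤ ∏ i : Fin N, Real.exp (-((p i - q i) ^ 2 / 8)) := by
          gcongr with i
          refine (hellinger_affinity_le (hp i).1.le (hp i).2.le (hq i).1.le (hq i).2.le).trans ?_
          linarith [Real.add_one_le_exp (-((p i - q i) ^ 2 / 8))]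
      _ = _ := by
          rw [← Real.exp_sum, Finset.sum_range, neg_div, Finset.sum_div, Finset.sum_neg_distrib]
  have hzero : ξ.real univ ≤ 0 := by
    refine le_of_forall_pos_le_add fun ε hε => ?_
    obtain ⟨N, hN⟩ := h (-8 * Real.log ε)
    refine (bound N).trans ?_
    rw [zero_add, ← Real.le_log_iff_exp_le hε]
    linarith
  have : ξ univ = 0 := (measureReal_eq_zero_iff).1 (le_antisymm hzero measureReal_nonneg)
  rw [Measure.measure_univ_eq_zero] at this
  exact this.le

lemma chiSq_factor_le {p q : ℝ} (hq0 : 1 / 4 ≤ q) (hq1 : q ≤ 3 / 4) :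
    p ^ 2 / q + (1 - p) ^ 2 / (1 - q) ≤ 1 + 8 * (p - q) ^ 2 := by
  have h0 : 0 < q := by linarith
  have h1 : 0 < 1 - q := by linarith
  have h : p ^ 2 / q + (1 - p) ^ 2 / (1 - q) = 1 + (p - q) ^ 2 / (q * (1 - q)) := by
    field_simp
    ring
  rw [h, add_le_add_iff_left, div_le_iff₀ (by positivity)]
  have : 1 ≤ 8 * (q * (1 - q)) := by nlinarith
  nlinarith [sq_nonneg (p - q)]

lemma sq_measureReal_preimage_initSeg_le {p q : ℕ → ℝ} {μ ν : Measure (ℕ → Bool)}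
    [IsFiniteMeasure μ] [IsFiniteMeasure ν] (hq : ∀ n, q n ∈ Icc (1 / 4 : ℝ) (3 / 4))
    (hμ : HasBernoulliCylinders p μ) (hν : HasBernoulliCylinders q ν) {C : ℝ}
    (hC : ∀ N, ∑ n ∈ Finset.range N, (p n - q n) ^ 2 ≤ C) (N : ℕ) (T : Finset (Fin N → Bool)) :
    μ.real (initSeg N ⁻¹' T) ^ 2 ≤ Real.exp (8 * C) * ν.real (initSeg N ⁻¹' T) := by
  have hqpos : ∀ (n : ℕ) b, 0 < bernoulliWeight (q n) b := fun n b =>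
    bernoulliWeight_pos (by linarith [(hq n).1]) (by linarith [(hq n).2]) b
  rw [← sum_measureReal_preimage_singleton T
      fun t _ => measurable_initSeg N (measurableSet_singleton t),
    ← sum_measureReal_preimage_singleton T
      fun t _ => measurable_initSeg N (measurableSet_singleton t)]
  simp_rw [hμ N, hν N]
  have hQ : ∀ t : Fin N → Bool, 0 < ∏ i : Fin N, bernoulliWeight (q i) (t i) := fun t =>
    Finset.prod_pos fun i _ => hqpos i _
  have hchi : ∑ t ∈ T, (∏ i : Fin N, bernoulliWeight (p i) (t i)) ^ 2 / ∏ i : Fin N, bernoulliWeight (q i) (t i)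
      ≤ Real.exp (8 * C) :=
    calc _ ≤ ∑ t : Fin N → Bool,
          (∏ i : Fin N, bernoulliWeight (p i) (t i)) ^ 2 / ∏ i : Fin N, bernoulliWeight (q i) (t i) :=
          Finset.sum_le_univ_sum_of_nonneg fun t => div_nonneg (sq_nonneg _) (hQ t).le
      _ = ∏ i : Fin N, (p i ^ 2 / q i + (1 - p i) ^ 2 / (1 - q i)) := by
          simp_rw [← Finset.prod_pow, ← Finset.prod_div_distrib]
          rw [sum_prod_bool fun i b => bernoulliWeight (p i) b ^ 2 / bernoulliWeight (q i) b]
          simp [bernoulliWeight]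
      _ ≤ ∏ i : Fin N, Real.exp (8 * (p i - q i) ^ 2) := by
          refine Finset.prod_le_prod (fun i _ => ?_) fun i _ => ?_
          · have h0 : 0 ≤ q i := by linarith [(hq i).1]
            have h1 : 0 ≤ 1 - q i := by linarith [(hq i).2]
            positivity
          · refine (chiSq_factor_le (hq i).1 (hq i).2).trans ?_
            linarith [Real.add_one_le_exp (8 * (p i - q i) ^ 2)]
      _ ≤ Real.exp (8 * C) := by
          rw [← Real.exp_sum, ← Finset.mul_sum,
            ← Finset.sum_range fun n => (p n - q n) ^ 2]
          gcongr
          exact hC N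
  rcases T.eq_empty_or_nonempty with rfl | hT
  · simp
  have hpos := Finset.sum_pos (fun t _ => hQ t) hT
  rw [← div_le_iff₀ hpos]
  exact (Finset.sq_sum_div_le_sum_sq_div T _ fun t _ => hQ t).trans hchi

lemma exists_iUnion_initSeg_preimage {U : Set (ℕ → Bool)} (hU : IsOpen U) :
    ∃ T : ∀ N, Finset (Fin N → Bool),
      Monotone (fun N => initSeg N ⁻¹' (T N : Set (Fin N → Bool))) ∧
      U = ⋃ N, initSeg N ⁻¹' (T N : Set (Fin N → Bool)) := by
  classical
  refine ⟨fun N => {t | initSeg N ⁻¹' {t} ⊆ U}, fun M N hMN g hg => ?_, ?_⟩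
  · simp only [Finset.coe_filter, Finset.mem_univ, true_and, mem_preimage, mem_ofPred_eq] at hg ⊢
    refine Subset.trans (fun g' hg' => ?_) hg
    ext i
    exact congrFun hg' (i.castLE hMN)
  · ext g
    simp only [Finset.coe_filter, Finset.mem_univ, true_and, mem_iUnion, mem_preimage,
      mem_ofPred_eq]
    refine ⟨fun hg => ?_, fun ⟨N, hN⟩ => hN rfl⟩
    obtain ⟨I, u, hu, hIU⟩ := isOpen_pi_iff.1 hU g hg
    refine ⟨I.sup id + 1, fun g' hg' => hIU fun n hn => ?_⟩
    have hlt : n < I.sup id + 1 := Nat.lt_succ_of_le (Finset.le_sup (f := id) hn)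
    have : g' n = g n := congrFun hg' ⟨n, hlt⟩
    rw [this]
    exact (hu n hn).2

lemma absolutelyContinuous_of_bounded {p q : ℕ → ℝ} {μ ν : Measure (ℕ → Bool)}
    [IsFiniteMeasure μ] [IsFiniteMeasure ν] (hq : ∀ n, q n ∈ Icc (1 / 4 : ℝ) (3 / 4))
    (hμ : HasBernoulliCylinders p μ) (hν : HasBernoulliCylinders q ν) {C : ℝ}
    (hC : ∀ N, ∑ n ∈ Finset.range N, (p n - q n) ^ 2 ≤ C) : μ ≪ ν := by
  have hopen : ∀ U : Set (ℕ → Bool), IsOpen U →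
      μ.real U ^ 2 ≤ Real.exp (8 * C) * ν.real U := by
    intro U hU
    obtain ⟨T, hmono, rfl⟩ := exists_iUnion_initSeg_preimage hU
    have hlim (m : Measure (ℕ → Bool)) [IsFiniteMeasure m] :=
      (ENNReal.tendsto_toReal (measure_ne_top m _)).comp
        (tendsto_measure_iUnion_atTop (μ := m) hmono)
    exact le_of_tendsto_of_tendsto' ((hlim μ).pow 2) ((hlim ν).const_mul _)
      fun N => sq_measureReal_preimage_initSeg_le hq hμ hν hC N (T N)
  intro A hA
  rw [← measureReal_eq_zero_iff, ← sq_eq_zero_iff]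
  refine le_antisymm (le_of_forall_pos_le_add fun ε hε => ?_) (sq_nonneg _)
  have hE := Real.exp_pos (8 * C)
  obtain ⟨U, hAU, hU, hνU⟩ := A.exists_isOpen_lt_of_lt (μ := ν)
    (ENNReal.ofReal (ε / Real.exp (8 * C))) (by rw [hA]; simp; positivity)
  have hνU' : ν.real U ≤ ε / Real.exp (8 * C) :=
    ENNReal.toReal_le_of_le_ofReal (by positivity) hνU.le
  calc μ.real A ^ 2 ≤ μ.real U ^ 2 := by
        gcongr
        exact measure_ne_top _ _
    _ ≤ Real.exp (8 * C) * ν.real U := hopen U hU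
    _ ≤ Real.exp (8 * C) * (ε / Real.exp (8 * C)) := by gcongr
    _ = 0 + ε := by field_simp; ring

lemma alphaSeq_mem_Icc (x : Set ℕ) (n : ℕ) : alphaSeq x n ∈ Icc (1 / 4 : ℝ) (3 / 4) := by
  unfold alphaSeq
  split_ifs
  · have h : ∀ k : ℕ, 1 ≤ √((k : ℝ) + 1) := fun k => Real.one_le_sqrt.2 (by simp)
    refine ⟨le_add_of_nonneg_right (by positivity), ?_⟩
    have h2 : ∀ k : ℕ, 1 / (2 * √((k : ℝ) + 1)) ≤ 1 / 2 := fun k => by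
      gcongr
      linarith [h k]
    linarith [h2 (@Nat.count (· ∈ x) (Classical.decPred _) n)]
  · norm_num

lemma IsKakutaniProduct.hasBernoulliCylinders {x : Set ℕ} {μ : Measure (ℕ → Bool)}
    (h : IsKakutaniProduct x μ) : HasBernoulliCylinders (alphaSeq x) μ := by
  intro N t
  have key := h.2 (Finset.range N) fun n => if hn : n < N then t ⟨n, hn⟩ else false
  have hset : {g : ℕ → Bool | ∀ n ∈ Finset.range N,
      g n = if hn : n < N then t ⟨n, hn⟩ else false} = initSeg N ⁻¹' {t} := by
    ext g
    simp only [Finset.mem_range, mem_ofPred_eq, mem_preimage, mem_singleton_iff, funext_iff,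
      initSeg]
    exact ⟨fun hg i => by simpa using hg i i.2, fun hg n hn => by simpa [hn] using hg ⟨n, hn⟩⟩
  rw [hset, Finset.prod_range] at key
  rw [Measure.real, key, ENNReal.toReal_prod]
  refine Finset.prod_congr rfl fun i _ => ?_
  have hα := alphaSeq_mem_Icc x i
  simp only [Fin.is_lt, dite_true, bernoulliWeight]
  split_ifs
  · exact ENNReal.toReal_ofReal (by linarith [hα.1])
  · exact ENNReal.toReal_ofReal (by linarith [hα.2])

lemma sum_range_le_toReal_rho {x y : Set ℕ} (h : rho x y < ⊤) (N : ℕ) :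
    ∑ n ∈ Finset.range N, (alphaSeq x n - alphaSeq y n) ^ 2 ≤ (rho x y).toReal := by
  rw [← ENNReal.ofReal_le_iff_le_toReal h.ne, ENNReal.ofReal_sum_of_nonneg fun _ _ => sq_nonneg _]
  exact ENNReal.sum_le_tsum _

lemma exists_le_sum_range_of_rho_eq_top {x y : Set ℕ} (h : rho x y = ⊤) (K : ℝ) :
    ∃ N, K ≤ ∑ n ∈ Finset.range N, (alphaSeq x n - alphaSeq y n) ^ 2 := by
  by_contra! hK
  have : rho x y ≤ ENNReal.ofReal K := by
    refine ENNReal.tsum_le_of_sum_range_le fun N => ?_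
    rw [← ENNReal.ofReal_sum_of_nonneg fun _ _ => sq_nonneg _]
    exact ENNReal.ofReal_le_ofReal (hK N).le
  exact (this.trans_lt ENNReal.ofReal_lt_top).ne h

/-- Kakutani's dichotomy for the measures `μ^x`: `μ^x` and `μ^y` are
equivalent iff `ρ(x,y) < ∞`, and mutually singular iff `ρ(x,y) = ∞`. -/
theorem kakutani_dichotomy (μ : Set ℕ → Measure (ℕ → Bool))
    (hμ : ∀ x : Set ℕ, IsKakutaniProduct x (μ x))
    (x y : Set ℕ) (hx : x.Infinite) (hy : y.Infinite) :
    ((μ x ≪ μ y ∧ μ y ≪ μ x) ↔ rho x y < ⊤) ∧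
    (Measure.MutuallySingular (μ x) (μ y) ↔ rho x y = ⊤) := by
  have := (hμ x).1
  have := (hμ y).1
  have hcx := (hμ x).hasBernoulliCylinders
  have hcy := (hμ y).hasBernoulliCylinders
  have hIoo : ∀ z n, alphaSeq z n ∈ Ioo (0 : ℝ) 1 := fun z n =>
    ⟨by linarith [(alphaSeq_mem_Icc z n).1], by linarith [(alphaSeq_mem_Icc z n).2]⟩
  have hac : rho x y < ⊤ → μ x ≪ μ y ∧ μ y ≪ μ x := fun h =>
    ⟨absolutelyContinuous_of_bounded (alphaSeq_mem_Icc y) hcx hcy (sum_range_le_toReal_rho h),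
      absolutelyContinuous_of_bounded (alphaSeq_mem_Icc x) hcy hcx fun N => by
        simpa only [sub_sq_comm] using sum_range_le_toReal_rho h N⟩
  have hsing : rho x y = ⊤ → μ x ⟂ₘ μ y := fun h =>
    mutuallySingular_of_unbounded (hIoo x) (hIoo y) hcx hcy (exists_le_sum_range_of_rho_eq_top h)
  have hexcl : μ x ≪ μ y → ¬ μ x ⟂ₘ μ y := fun hxy hs =>
    IsProbabilityMeasure.ne_zero (μ x) (Measure.eq_zero_of_absolutelyContinuous_of_mutuallySingular
      hxy hs)
  refine ⟨⟨fun h => ?_, hac⟩, ⟨fun h => ?_, hsing⟩⟩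
  · exact lt_top_iff_ne_top.2 fun htop => hexcl h.1 (hsing htop)
  · by_contra hne
    exact hexcl (hac (lt_top_iff_ne_top.2 hne)).1 h

end
end

section
/- Let X be a Polish space and let ϑ : [ω]^ω → X^ω be continuous (with respect to the subspace topology on [ω]^ω from Cantor space and the product topology on X^ω). Suppose ϑ is (F, F₂)-equivariant, i.e., for every g ∈ F and every x ∈ [ω]^ω the sets {ϑ(g·x)_n : n ∈ ω} and {ϑ(x)_n : n ∈ ω} are equal. Then there is a nonempty open set U ⊆ [ω]^ω and a point c ∈ X such that ϑ(x)_0 = c for all x ∈ U. -/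
open MeasureTheory Filter Set
open scoped ENNReal

noncomputable section

lemma sum_range_inv_count_eq (p : ℕ → Prop) [DecidablePred p] (N : ℕ) :
    ∑ n ∈ Finset.range N, (if p n then 1 / ((Nat.count p n : ℝ) + 1) else 0) =
      ∑ i ∈ Finset.range (Nat.count p N), 1 / ((i : ℝ) + 1) := by
  induction N with
  | zero => simp
  | succ N ih =>
    rw [Finset.sum_range_succ, ih, Nat.count_succ]
    split_ifs <;> simp [Finset.sum_range_succ]

lemma alphaSeq_univ (n : ℕ) : alphaSeq univ n = 1 / 4 + 1 / (2 * √((n : ℝ) + 1)) := by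
  simp only [alphaSeq, mem_univ, if_true]
  rw [Nat.count_of_forall (fun _ _ => trivial)]

lemma sq_inv_sqrt_sub_le {a b : ℝ} (ha : 0 < a) (hab : a ≤ b) :
    (1 / (2 * √a) - 1 / (2 * √b)) ^ 2 ≤ (1 / a - 1 / b) / 4 := by
  have hb : 0 < b := ha.trans_le hab
  have key : ∀ u v : ℝ, 0 ≤ v → v ≤ u → (u / 2 - v / 2) ^ 2 ≤ (u ^ 2 - v ^ 2) / 4 :=
    fun u v hv huv => by nlinarith [mul_nonneg hv (sub_nonneg.2 huv)]
  have h := key (1 / √a) (1 / √b) (by positivity)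
    (one_div_le_one_div_of_le (Real.sqrt_pos.2 ha) (Real.sqrt_le_sqrt hab))
  rw [div_pow, div_pow, Real.sq_sqrt ha.le, Real.sq_sqrt hb.le, one_pow] at h
  convert h using 2
  rw [div_div, div_div, mul_comm 2, mul_comm 2]

lemma infinite_compl_of_summable {A : Set ℕ}
    (hA : Summable (A.indicator fun n : ℕ => 1 / ((n : ℝ) + 1))) : Aᶜ.Infinite := by
  intro hfin
  have hc : Summable (Aᶜ.indicator fun n : ℕ => 1 / ((n : ℝ) + 1)) :=
    summable_of_hasFiniteSupport (hfin.subset support_indicator_subset)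
  have h : Summable (A.indicator (fun n : ℕ => 1 / ((n : ℝ) + 1)) +
      Aᶜ.indicator fun n : ℕ => 1 / ((n : ℝ) + 1)) := hA.add hc
  rw [indicator_self_add_compl] at h
  apply Real.not_summable_one_div_natCast
  rw [← summable_nat_add_iff 1]
  exact_mod_cast h

/-- The complement of a set in the summable ideal belongs to `F`. -/
lemma compl_mem_Fset {A : Set ℕ}
    (hA : Summable (A.indicator fun n : ℕ => 1 / ((n : ℝ) + 1))) : Aᶜ ∈ Fset := by
  classical
  refine ⟨infinite_compl_of_summable hA, Summable.tsum_ofReal_lt_top ?_⟩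
  set w : ℕ → ℝ := fun n => 1 / ((n : ℝ) + 1) with hw
  have hw0 : ∀ n, 0 ≤ w n := fun n => by positivity
  refine summable_of_sum_range_le (c := ∑' n, A.indicator w n) (fun n => sq_nonneg _) fun N => ?_
  have hterm : ∀ n, (alphaSeq Aᶜ n - alphaSeq univ n) ^ 2 ≤
      ((if n ∈ Aᶜ then 1 / ((Nat.count (· ∈ Aᶜ) n : ℝ) + 1) else 0) - w n) / 4
        + A.indicator w n / 2 := by
    intro n
    rw [alphaSeq_univ]
    by_cases hn : n ∈ A
    · have h : ((0 : ℝ) - 1 / (2 * √((n : ℝ) + 1))) ^ 2 = w n / 4 := by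
        rw [zero_sub, neg_sq, div_pow, mul_pow, Real.sq_sqrt (by positivity)]
        simp only [hw]
        field_simp
        norm_num
      simp only [alphaSeq, mem_compl_iff, hn, not_true_eq_false, if_false, indicator_of_mem]
      rw [sub_add_eq_sub_sub, sub_self, h]
      linarith
    · have hn' : n ∈ Aᶜ := hn
      simp only [alphaSeq, if_pos hn', indicator_of_notMem hn, add_sub_add_left_eq_sub, zero_div,
        add_zero]
      convert sq_inv_sqrt_sub_le (a := (Nat.count (· ∈ Aᶜ) n : ℝ) + 1) (b := n + 1)
        (by positivity) (by gcongr; exact Nat.count_le _) using 1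
      congr!
  calc ∑ n ∈ Finset.range N, (alphaSeq Aᶜ n - alphaSeq univ n) ^ 2
      ≤ ∑ n ∈ Finset.range N, (((if n ∈ Aᶜ then 1 / ((Nat.count (· ∈ Aᶜ) n : ℝ) + 1) else 0)
          - w n) / 4 + A.indicator w n / 2) := Finset.sum_le_sum fun n _ => hterm n
    _ = (∑ i ∈ Finset.range (Nat.count (· ∈ Aᶜ) N), w i - ∑ i ∈ Finset.range N, w i) / 4
          + (∑ n ∈ Finset.range N, A.indicator w n) / 2 := by
        rw [Finset.sum_add_distrib, ← Finset.sum_div, ← Finset.sum_div, Finset.sum_sub_distrib,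
          sum_range_inv_count_eq]
    _ ≤ ∑' n, A.indicator w n := by
        have h1 : ∑ i ∈ Finset.range (Nat.count (· ∈ Aᶜ) N), w i ≤ ∑ i ∈ Finset.range N, w i :=
          Finset.sum_le_sum_of_subset_of_nonneg
            (Finset.range_mono (Nat.count_le _)) fun i _ _ => hw0 i
        have hnn : ∀ n, 0 ≤ A.indicator w n := fun n => indicator_nonneg (fun n _ => hw0 n) n
        have h2 := hA.sum_le_tsum (Finset.range N) fun n _ => hnn n
        have h3 : 0 ≤ ∑ n ∈ Finset.range N, A.indicator w n := Finset.sum_nonneg fun n _ => hnn n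
        linarith

/-- A sparse set of positions coded by `d`: it has at most one element for each `k`, and that
element is at least `2 ^ k`. -/
def sparseSet (d : ℕ → ℕ) : Set ℕ := {n | ∃ k, 2 ^ k ≤ n ∧ d k = n}

lemma summable_indicator_sparseSet (d : ℕ → ℕ) :
    Summable ((sparseSet d).indicator fun n : ℕ => 1 / ((n : ℝ) + 1)) := by
  classical
  refine summable_of_sum_le (c := ∑' k : ℕ, (1 / 2 : ℝ) ^ k)
    (fun n => indicator_nonneg (fun n _ => by positivity) n) fun s => ?_
  choose! k hk using fun n (hn : n ∈ sparseSet d) => hn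
  have hinj : Set.InjOn k (s.filter (· ∈ sparseSet d)) := by
    intro m hm n hn hmn
    simp only [Finset.coe_filter, mem_ofPred_eq] at hm hn
    rw [← (hk m hm.2).2, ← (hk n hn.2).2, hmn]
  calc ∑ n ∈ s, (sparseSet d).indicator (fun n : ℕ => 1 / ((n : ℝ) + 1)) n
      = ∑ n ∈ s.filter (· ∈ sparseSet d), 1 / ((n : ℝ) + 1) := by
        simp only [indicator_apply, Finset.sum_filter]
    _ ≤ ∑ n ∈ s.filter (· ∈ sparseSet d), (1 / 2 : ℝ) ^ k n := by
        refine Finset.sum_le_sum fun n hn => ?_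
        have h : (2 : ℝ) ^ k n ≤ n := mod_cast (hk n (Finset.mem_filter.1 hn).2).1
        rw [one_div_pow]
        exact one_div_le_one_div_of_le (by positivity) (by linarith)
    _ = ∑ j ∈ (s.filter (· ∈ sparseSet d)).image k, (1 / 2 : ℝ) ^ j :=
        (Finset.sum_image hinj).symm
    _ ≤ ∑' k : ℕ, (1 / 2 : ℝ) ^ k :=
        summable_geometric_two.sum_le_tsum _ fun _ _ => by positivity

lemma dotOp_eq (g x : Set ℕ) [DecidablePred (· ∈ x)] (hg : g.Infinite) (hx : x.Infinite) :
    dotOp g x = {m | m ∈ x ∧ Nat.count (· ∈ x) m ∈ g} := by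
  ext m
  have hgr : range (Nat.nth (· ∈ g)) = g := Nat.range_nth_of_infinite hg
  simp only [dotOp, fEnum, range_comp, hgr, mem_image, mem_ofPred_eq]
  constructor
  · rintro ⟨n, hn, rfl⟩
    exact ⟨Nat.nth_mem_of_infinite hx n, by rwa [Nat.count_nth_of_infinite (p := (· ∈ x)) hx]⟩
  · exact fun ⟨hm, hc⟩ => ⟨_, hc, Nat.nth_count (p := (· ∈ x)) hm⟩

open Classical in
/-- Remove from the set coded by `p` its elements at the positions in `sparseSet d`. -/
def thin (d : ℕ → ℕ) (p : ℕ → Bool) : ℕ → Bool :=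
  fun m => p m && decide (Nat.count (fun i => p i = true) m ∉ sparseSet d)

lemma thin_eq_true_iff {d : ℕ → ℕ} {p : ℕ → Bool} {m : ℕ} :
    thin d p m = true ↔ p m = true ∧ Nat.count (fun i => p i = true) m ∉ sparseSet d := by
  simp [thin]

lemma toSet_thin (d : ℕ → ℕ) {p : ℕ → Bool} (hp : (toSet p).Infinite) :
    toSet (thin d p) = dotOp (sparseSet d)ᶜ (toSet p) := by
  let _ : DecidablePred (· ∈ toSet p) := fun m => inferInstanceAs (Decidable (p m = true))
  rw [dotOp_eq _ _ (infinite_compl_of_summable (summable_indicator_sparseSet d)) hp]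
  ext m
  exact thin_eq_true_iff

lemma infinite_toSet_thin (d : ℕ → ℕ) {p : ℕ → Bool} (hp : (toSet p).Infinite) :
    (toSet (thin d p)).Infinite := by
  rw [toSet_thin d hp, dotOp]
  refine infinite_range_of_injective ?_
  exact (Nat.nth_injective hp).comp
    (Nat.nth_injective (infinite_compl_of_summable (summable_indicator_sparseSet d)))

lemma count_congr_lt {p q : ℕ → Prop} [DecidablePred p] [DecidablePred q] {m : ℕ}
    (h : ∀ i < m, (p i ↔ q i)) : Nat.count p m = Nat.count q m := by
  induction m with
  | zero => simp
  | succ m ih =>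
    rw [Nat.count_succ, Nat.count_succ, ih fun i hi => h i (hi.trans m.lt_succ_self),
      if_congr (h m m.lt_succ_self) rfl rfl]

lemma thin_congr {d d' : ℕ → ℕ} {p p' : ℕ → Bool} {m : ℕ} (hd : ∀ k < m, d k = d' k)
    (hp : ∀ i ≤ m, p i = p' i) : thin d p m = thin d' p' m := by
  rw [Bool.eq_iff_iff, thin_eq_true_iff, thin_eq_true_iff, hp m le_rfl,
    count_congr_lt (q := fun i => p' i = true) fun i hi => by rw [hp i hi.le]]
  refine and_congr_right fun _ => not_congr (exists_congr fun k => and_congr_right fun hk => ?_)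
  rw [hd k (k.lt_two_pow_self.trans_le (hk.trans (Nat.count_le _)))]

lemma continuous_thin : Continuous fun e : (ℕ → ℕ) × (ℕ → Bool) => thin e.1 e.2 := by
  refine continuous_pi fun m => continuous_iff_continuousAt.2 fun e => ?_
  have h1 : ∀ᶠ y : (ℕ → ℕ) × (ℕ → Bool) in nhds e, ∀ k ∈ Finset.range (m + 1), y.1 k = e.1 k :=
    (Finset.eventually_all _).2 fun k _ =>
      ((continuous_apply k).comp continuous_fst).continuousAt.eventually
        ((isOpen_discrete {e.1 k}).mem_nhds rfl)
  have h2 : ∀ᶠ y : (ℕ → ℕ) × (ℕ → Bool) in nhds e, ∀ k ∈ Finset.range (m + 1), y.2 k = e.2 k :=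
    (Finset.eventually_all _).2 fun k _ =>
      ((continuous_apply k).comp continuous_snd).continuousAt.eventually
        ((isOpen_discrete {e.2 k}).mem_nhds rfl)
  refine continuousAt_const.congr (f := fun _ => thin e.1 e.2 m) ?_
  filter_upwards [h1, h2] with y hy1 hy2
  exact thin_congr (fun k hk => (hy1 k (Finset.mem_range.2 (by omega))).symm)
    fun i hi => (hy2 i (Finset.mem_range.2 (by omega))).symm

/-- The sequence that follows `f` below `n` and `g` from `n` on. -/
def splice {α : Type*} (f g : ℕ → α) (n : ℕ) : ℕ → α := fun i => if i < n then f i else g i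

lemma splice_of_lt {α : Type*} (f g : ℕ → α) {n i : ℕ} (h : i < n) : splice f g n i = f i :=
  if_pos h

lemma splice_of_le {α : Type*} (f g : ℕ → α) {n i : ℕ} (h : n ≤ i) : splice f g n i = g i :=
  if_neg h.not_gt

lemma tendsto_splice {α : Type*} [TopologicalSpace α] (f g : ℕ → α) :
    Tendsto (splice f g) atTop (nhds f) :=
  tendsto_pi_nhds.2 fun i => tendsto_const_nhds.congr' <|
    (eventually_gt_atTop i).mono fun _ hn => (splice_of_lt f g hn).symm

lemma infinite_toSet_of_eventually_eq {p q : ℕ → Bool} {n : ℕ} (h : ∀ i, n ≤ i → q i = p i)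
    (hp : (toSet p).Infinite) : (toSet q).Infinite := by
  refine (hp.sdiff (finite_lt_nat n)).mono fun i hi => ?_
  have hni : n ≤ i := not_lt.1 hi.2
  exact (h i hni).trans hi.1

lemma isGδ_infinite_toSet : IsGδ {p : ℕ → Bool | (toSet p).Infinite} := by
  have : {p : ℕ → Bool | (toSet p).Infinite} = ⋂ n, ⋃ m, ⋃ (_ : n < m), (fun p => p m) ⁻¹' {true} := by
    ext p
    simp [← Nat.frequently_atTop_iff_infinite, frequently_atTop', toSet]
  rw [this]
  exact IsGδ.iInter_of_isOpen fun n => isOpen_iUnion fun m => isOpen_iUnion fun _ =>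
    (isOpen_discrete {true}).preimage (continuous_apply m)

lemma dense_infinite_toSet : Dense {p : ℕ → Bool | (toSet p).Infinite} := fun p =>
  mem_closure_of_tendsto (tendsto_splice p fun _ => true) <| Eventually.of_forall fun n =>
    infinite_toSet_of_eventually_eq (p := fun _ => true) (n := n) (fun _ => splice_of_le _ _)
      (by simpa [toSet] using infinite_univ)

lemma exists_forall_agree_mem {α : Type*} [TopologicalSpace α] {f : ℕ → α} {O : Set (ℕ → α)}
    (hO : O ∈ nhds f) : ∃ N, ∀ g : ℕ → α, (∀ i < N, g i = f i) → g ∈ O := by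
  obtain ⟨V, hVO, hV, hfV⟩ := mem_nhds_iff.1 hO
  obtain ⟨I, u, hu, huV⟩ := isOpen_pi_iff.1 hV f hfV
  refine ⟨I.sup id + 1, fun g hg => hVO (huV fun i hi => ?_)⟩
  rw [hg i (Nat.lt_succ_of_le (Finset.le_sup (f := id) hi))]
  exact (hu i hi).2

/-- Switch off the bit `m`. -/
def eraseBit (y : {f : ℕ → Bool // (toSet f).Infinite}) (m : ℕ) :
    {f : ℕ → Bool // (toSet f).Infinite} :=
  ⟨Function.update y.1 m false, infinite_toSet_of_eventually_eq (n := m + 1)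
    (fun i hi => Function.update_of_ne (by omega) _ _) y.2⟩

lemma eq_of_eraseBit_eq {X : Type*} [TopologicalSpace X] [T2Space X]
    {h : {f : ℕ → Bool // (toSet f).Infinite} → X} (hc : Continuous h) {L : ℕ}
    (y z : {f : ℕ → Bool // (toSet f).Infinite}) (hyz : ∀ i < L, y.1 i = z.1 i)
    (herase : ∀ x : {f : ℕ → Bool // (toSet f).Infinite}, (∀ i < L, x.1 i = z.1 i) →
      ∀ m, L ≤ m → h (eraseBit x m) = h x) :
    h y = h z := by
  have hgap : ∀ x : {f : ℕ → Bool // (toSet f).Infinite}, (∀ i < L, x.1 i = z.1 i) →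
      ∀ n, ∃ x' : {f : ℕ → Bool // (toSet f).Infinite}, h x' = h x ∧
        ∀ i, x'.1 i = if L ≤ i ∧ i < n then false else x.1 i := by
    intro x hx n
    induction n with
    | zero => exact ⟨x, rfl, by simp⟩
    | succ n ih =>
      obtain ⟨x', hx', hi⟩ := ih
      by_cases hn : L ≤ n
      · refine ⟨eraseBit x' n, (herase x' (fun i hiL => ?_) n hn).trans hx', fun i => ?_⟩
        · rw [hi, if_neg (by omega), hx i hiL]
        · simp only [eraseBit, Function.update_apply, hi]
          split_ifs <;> first | rfl | omega
      · refine ⟨x', hx', fun i => ?_⟩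
        rw [hi]
        split_ifs <;> first | rfl | omega
  let s : ℕ → {f : ℕ → Bool // (toSet f).Infinite} := fun n =>
    ⟨splice y.1 z.1 n, infinite_toSet_of_eventually_eq (fun _ => splice_of_le _ _) z.2⟩
  have hs : ∀ n, h (s n) = h z := by
    intro n
    have hsn : ∀ i < L, (s n).1 i = z.1 i := fun i hi => by
      rcases lt_or_ge i n with hin | hin
      · exact (splice_of_lt _ _ hin).trans (hyz i hi)
      · exact splice_of_le _ _ hin
    obtain ⟨a, ha, hai⟩ := hgap (s n) hsn n
    obtain ⟨b, hb, hbi⟩ := hgap z (fun _ _ => rfl) n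
    have hab : a = b := Subtype.ext (funext fun i => by
      rw [hai, hbi]
      split_ifs with hi
      · rfl
      · rcases lt_or_ge i L with hiL | hiL
        · exact hsn i hiL
        · exact splice_of_le _ _ (by omega))
    rw [← ha, ← hb, hab]
  have ht : Tendsto s atTop (nhds y) := tendsto_subtype_rng.2 (tendsto_splice y.1 z.1)
  exact tendsto_nhds_unique ((hc.tendsto y).comp ht) (tendsto_const_nhds.congr fun n => (hs n).symm)

/-- Baire category: on a basic open set of pairs `(d, p)`, the value `ϑ (thin d p) 0` is a fixed
coordinate of `ϑ p`. -/
lemma exists_thin_apply_eq {X : Type*} [TopologicalSpace X] [T2Space X]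
    (ϑ : {f : ℕ → Bool // (toSet f).Infinite} → ℕ → X) (hcont : Continuous ϑ)
    (hequiv : ∀ g ∈ Fset, ∀ p q : {f : ℕ → Bool // (toSet f).Infinite},
      toSet q.1 = dotOp g (toSet p.1) → Set.range (ϑ q) = Set.range (ϑ p)) :
    ∃ (j N : ℕ) (d₀ : ℕ → ℕ) (p₀ : {f : ℕ → Bool // (toSet f).Infinite}),
      ∀ (d : ℕ → ℕ) (p : {f : ℕ → Bool // (toSet f).Infinite}), (∀ i < N, d i = d₀ i) →
        (∀ i < N, p.1 i = p₀.1 i) → ϑ ⟨thin d p.1, infinite_toSet_thin d p.2⟩ 0 = ϑ p j := by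
  let T : Set ((ℕ → ℕ) × (ℕ → Bool)) := {e | (toSet e.2).Infinite}
  have hG : IsGδ T := isGδ_infinite_toSet.preimage continuous_snd
  have hD : Dense T := dense_infinite_toSet.preimage isOpenMap_snd
  have : BaireSpace T := hG.baireSpace_of_dense hD
  have : Nonempty T := hD.nonempty.to_subtype
  let base : T → {f : ℕ → Bool // (toSet f).Infinite} := fun e => ⟨e.1.2, e.2⟩
  let act : T → {f : ℕ → Bool // (toSet f).Infinite} := fun e =>
    ⟨thin e.1.1 e.1.2, infinite_toSet_thin e.1.1 e.2⟩
  have hbase : Continuous base := (continuous_snd.comp continuous_subtype_val).subtype_mk _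
  have hact : Continuous act := (continuous_thin.comp continuous_subtype_val).subtype_mk _
  obtain ⟨j, e, he⟩ := nonempty_interior_of_iUnion_of_closed
    (f := fun j : ℕ => {e : T | ϑ (act e) 0 = ϑ (base e) j})
    (fun j => isClosed_eq ((continuous_apply 0).comp (hcont.comp hact))
      ((continuous_apply j).comp (hcont.comp hbase)))
    (eq_univ_of_forall fun e => by
      have h := hequiv _ (compl_mem_Fset (summable_indicator_sparseSet e.1.1)) (base e) (act e)
        (toSet_thin _ e.2)
      obtain ⟨j, hj⟩ := h ▸ mem_range_self (f := ϑ (act e)) 0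
      exact mem_iUnion.2 ⟨j, hj.symm⟩)
  obtain ⟨W, hW, hWs⟩ := (mem_nhds_subtype T e _).1 (mem_interior_iff_mem_nhds.1 he)
  obtain ⟨V₁, h₁, V₂, h₂, hV⟩ := mem_nhds_prod_iff.1 hW
  obtain ⟨N₁, hN₁⟩ := exists_forall_agree_mem h₁
  obtain ⟨N₂, hN₂⟩ := exists_forall_agree_mem h₂
  refine ⟨j, max N₁ N₂, e.1.1, base e, fun d p hd hp => ?_⟩
  have hmem : (d, p.1) ∈ W := hV ⟨hN₁ d fun i hi => hd i (lt_max_of_lt_left hi),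
    hN₂ p.1 fun i hi => hp i (lt_max_of_lt_right hi)⟩
  exact hWs (show (⟨(d, p.1), p.2⟩ : T) ∈ Subtype.val ⁻¹' W from hmem)

/-- (Hjorth-style lemma.) Let `X` be Polish and `ϑ : [ω]^ω → X^ω` be continuous,
where `[ω]^ω` carries the subspace topology from Cantor space (via characteristic
functions). If `ϑ` is `(F, F₂)`-equivariant, i.e. `{ϑ(g·x)_n : n} = {ϑ(x)_n : n}`
for all `g ∈ F` and `x ∈ [ω]^ω`, then `ϑ₀ = ϑ(·)_0` is constant on some nonempty
open subset of `[ω]^ω`. -/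
theorem hjorth_local_constancy {X : Type*} [TopologicalSpace X] [PolishSpace X]
    (ϑ : {f : ℕ → Bool // (toSet f).Infinite} → ℕ → X)
    (hcont : Continuous ϑ)
    (hequiv : ∀ g ∈ Fset, ∀ p q : {f : ℕ → Bool // (toSet f).Infinite},
      toSet q.1 = dotOp g (toSet p.1) → Set.range (ϑ q) = Set.range (ϑ p)) :
    ∃ U : Set {f : ℕ → Bool // (toSet f).Infinite},
      IsOpen U ∧ U.Nonempty ∧ ∃ c : X, ∀ p ∈ U, ϑ p 0 = c := by
  classical
  obtain ⟨j, N, d₀, p₀, hj⟩ := exists_thin_apply_eq ϑ hcont hequiv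
  let d : ℕ → ℕ := splice d₀ 0 N
  obtain ⟨B, hB⟩ : ∃ B, 2 ^ N ≤ B ∧ ∀ k < N, d k < B :=
    ⟨2 ^ N + (Finset.range N).sup d + 1, by omega, fun k hk => by
      have h : d k ≤ (Finset.range N).sup d := Finset.le_sup (Finset.mem_range.2 hk)
      have := Nat.two_pow_pos N
      omega⟩
  obtain ⟨L₀, hL₀⟩ := Nat.surjective_count_of_infinite_setOfPred
    (p := fun i => p₀.1 i = true) p₀.2 B
  let L := max N L₀
  let z : {f : ℕ → Bool // (toSet f).Infinite} := ⟨thin d p₀.1, infinite_toSet_thin d p₀.2⟩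
  refine ⟨{y | ∀ i < L, y.1 i = z.1 i}, ?_, ⟨z, fun _ _ => rfl⟩, ϑ z 0, fun y hy =>
    eq_of_eraseBit_eq (h := fun y => ϑ y 0) ((continuous_apply 0).comp hcont) y z hy ?_⟩
  · have : {y : {f : ℕ → Bool // (toSet f).Infinite} | ∀ i < L, y.1 i = z.1 i} =
        ⋂ i ∈ Finset.range L, (fun y => y.1 i) ⁻¹' {z.1 i} := by
      ext y
      simp
    rw [this]
    exact isOpen_biInter_finset fun i _ =>
      (isOpen_discrete {z.1 i}).preimage ((continuous_apply i).comp continuous_subtype_val)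
  intro y hy m hm
  by_cases hym : y.1 m = true
  swap
  · have : eraseBit y m = y := Subtype.ext (by simp_all [eraseBit])
    rw [this]
  let x : {f : ℕ → Bool // (toSet f).Infinite} :=
    ⟨splice p₀.1 y.1 L, infinite_toSet_of_eventually_eq (fun _ => splice_of_le _ _) y.2⟩
  have hxlt : ∀ i < L, x.1 i = p₀.1 i := fun i hi => splice_of_lt _ _ hi
  have hxge : ∀ i, L ≤ i → x.1 i = y.1 i := fun i hi => splice_of_le _ _ hi
  have hcount : ∀ i, L ≤ i → B ≤ Nat.count (fun i => x.1 i = true) i := fun i hi => by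
    rw [← hL₀, count_congr_lt (q := fun i => x.1 i = true) fun i hi => by
      rw [hxlt i (lt_max_of_lt_right hi)]]
    exact Nat.count_monotone _ ((le_max_right N L₀).trans hi)
  have hd : ∀ k, N ≤ k → d k = 0 := fun k hk => splice_of_le _ _ hk
  let n := Nat.count (fun i => x.1 i = true) m
  have hnB : B ≤ n := hcount m hm
  let d' : ℕ → ℕ := Function.update d N n
  have hd'lt : ∀ k < N, d' k = d k := fun k hk => Function.update_of_ne hk.ne _ _
  have hmem : ∀ c, c ∈ sparseSet d' ↔ c ∈ sparseSet d ∨ c = n := by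
    intro c
    constructor
    · rintro ⟨k, hk, hkc⟩
      by_cases hkN : k = N
      · subst hkN
        exact Or.inr (by simpa [d'] using hkc.symm)
      · exact Or.inl ⟨k, hk, (Function.update_of_ne hkN _ _).symm.trans hkc⟩
    · rintro (⟨k, hk, hkc⟩ | rfl)
      · have hkN : k ≠ N := by
          rintro rfl
          rw [hd _ le_rfl] at hkc
          have := Nat.two_pow_pos k
          omega
        exact ⟨k, hk, (Function.update_of_ne hkN _ _).trans hkc⟩
      · exact ⟨N, hB.1.trans hnB, Function.update_self _ _ _⟩
  have hsparse : ∀ c, B ≤ c → c ∉ sparseSet d := by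
    rintro c hc ⟨k, hk, hkc⟩
    rcases lt_or_ge k N with hkN | hkN
    · have := hB.2 k hkN
      omega
    · rw [hd k hkN] at hkc
      have := Nat.two_pow_pos k
      omega
  have hthin : thin d x.1 = y.1 := by
    funext i
    rcases lt_or_ge i L with hi | hi
    · rw [hy i hi]
      exact thin_congr (fun _ _ => rfl) fun k hk => hxlt k (hk.trans_lt hi)
    · rw [Bool.eq_iff_iff, thin_eq_true_iff, hxge i hi]
      exact and_iff_left (hsparse _ (hcount i hi))
  have hthin' : thin d' x.1 = (eraseBit y m).1 := by
    funext i
    have hxm : x.1 m = true := (hxge m hm).trans hym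
    have key : thin d' x.1 i = true ↔ thin d x.1 i = true ∧ i ≠ m := by
      rw [thin_eq_true_iff, thin_eq_true_iff, hmem, not_or, and_assoc]
      refine and_congr_right fun hxi => and_congr_right fun _ => not_congr ⟨fun h => ?_, ?_⟩
      · exact Nat.count_injective (p := fun i => x.1 i = true) hxi hxm h
      · rintro rfl
        rfl
    rw [hthin] at key
    rw [Bool.eq_iff_iff, key]
    by_cases him : i = m <;> simp [eraseBit, him]
  have hxN : ∀ i < N, x.1 i = p₀.1 i := fun i hi => hxlt i (lt_max_of_lt_left hi)
  have hdN : ∀ k < N, d k = d₀ k := fun k hk => splice_of_lt _ _ hk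
  have e₁ := hj d x hdN hxN
  have e₂ := hj d' x (fun k hk => (hd'lt k hk).trans (hdN k hk)) hxN
  simp only [hthin, hthin'] at e₁ e₂
  exact e₂.trans e₁.symm

end
end

section
/- There is no analytic maximal orthogonal family of Borel probability measures on Cantor space: if A ⊆ P(2^ω) is an analytic set of pairwise mutually singular Borel probability measures, then A is not maximal; that is, there exists a Borel probability measure ν ∉ A such that ν is mutually singular with every member of A. -/
open MeasureTheory Filter Set
open scoped ENNReal

noncomputable section

/-- The largest open set in which `A` is meagre. -/
def meagrePart {X : Type*} [TopologicalSpace X] (A : Set X) : Set X :=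
  ⋃₀ {U | IsOpen U ∧ IsMeagre (A ∩ U)}

lemma isOpen_meagrePart {X : Type*} [TopologicalSpace X] (A : Set X) : IsOpen (meagrePart A) :=
  isOpen_sUnion fun _ hU => hU.1

lemma subset_meagrePart {X : Type*} [TopologicalSpace X] {A U : Set X} (hU : IsOpen U)
    (h : IsMeagre (A ∩ U)) : U ⊆ meagrePart A :=
  subset_sUnion_of_mem (show U ∈ {U | IsOpen U ∧ IsMeagre (A ∩ U)} from ⟨hU, h⟩)

lemma compl_meagrePart_subset_closure {X : Type*} [TopologicalSpace X] (A : Set X) :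
    (meagrePart A)ᶜ ⊆ closure A := by
  rw [compl_subset_comm]
  refine subset_meagrePart isClosed_closure.isOpen_compl ?_
  have : A ∩ (closure A)ᶜ = ∅ := by
    rw [← disjoint_iff_inter_eq_empty]
    exact disjoint_compl_right.mono_left subset_closure
  rw [this]
  exact IsMeagre.empty

lemma isMeagre_inter_meagrePart {X : Type*} [TopologicalSpace X] [SecondCountableTopology X]
    (A : Set X) : IsMeagre (A ∩ meagrePart A) := by
  obtain ⟨T, hTc, hTS, hT⟩ := TopologicalSpace.isOpen_sUnion_countable
    {U | IsOpen U ∧ IsMeagre (A ∩ U)} fun _ hU => hU.1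
  rw [meagrePart, ← hT, sUnion_eq_biUnion, inter_iUnion₂]
  exact isMeagre_biUnion hTc fun U hU => (hTS hU).2

/-- The envelope `(meagrePart A)ᶜ` of a countable union is, up to a meagre set, covered by the
envelopes of the pieces. -/
lemma isMeagre_diff_envelope {X : Type*} [TopologicalSpace X] [SecondCountableTopology X]
    {A : Set X} {B : ℕ → Set X} (hAB : A ⊆ ⋃ n, B n) :
    IsMeagre ((meagrePart A)ᶜ \ ⋃ n, (meagrePart (B n))ᶜ) := by
  borelize X
  set H := (meagrePart A)ᶜ \ ⋃ n, (meagrePart (B n))ᶜ with hH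
  have hHm : MeasurableSet H :=
    (isOpen_meagrePart A).measurableSet.compl.diff
      (MeasurableSet.iUnion fun n => (isOpen_meagrePart (B n)).measurableSet.compl)
  obtain ⟨U, hU, hUH⟩ := hHm.baireMeasurableSet.residualEq_isOpen
  have hAH : IsMeagre (A ∩ H) := by
    refine (isMeagre_iUnion fun n => isMeagre_inter_meagrePart (B n)).mono ?_
    rintro x ⟨hxA, hxH⟩
    obtain ⟨n, hn⟩ := mem_iUnion.1 (hAB hxA)
    refine mem_iUnion.2 ⟨n, hn, ?_⟩
    by_contra hx
    exact hxH.2 (mem_iUnion.2 ⟨n, hx⟩)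
  have hUdH : IsMeagre (U \ H) := by
    filter_upwards [hUH] with x hx hx'
    exact hx'.2 ((show (x ∈ H) = (x ∈ U) from hx).symm ▸ hx'.1)
  have hHdU : IsMeagre (H \ U) := by
    filter_upwards [hUH] with x hx hx'
    exact hx'.2 ((show (x ∈ H) = (x ∈ U) from hx) ▸ hx'.1)
  have hUA : U ⊆ meagrePart A := by
    refine subset_meagrePart hU ((hAH.union hUdH).mono ?_)
    rintro x ⟨hxA, hxU⟩
    by_cases hx : x ∈ H
    · exact Or.inl ⟨hxA, hx⟩
    · exact Or.inr ⟨hxU, hx⟩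
  refine hHdU.mono ?_
  exact fun x hx => ⟨hx, fun hxU => hx.1 (hUA hxU)⟩

/-- Analytic sets have the property of Baire. -/
theorem AnalyticSet.baireMeasurableSet {X : Type*} [TopologicalSpace X]
    [SecondCountableTopology X] [T2Space X] {A : Set X} (hA : AnalyticSet A) :
    BaireMeasurableSet A := by
  rw [AnalyticSet] at hA
  obtain rfl | ⟨f, hf, rfl⟩ := hA
  · exact IsMeagre.empty.baireMeasurableSet
  let A : List ℕ → Set X := fun l => f '' {a | PiNat.res a l.length = l}
  have hAsub : ∀ l, A l ⊆ ⋃ n, A (n :: l) := by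
    rintro l _ ⟨a, ha, rfl⟩
    refine mem_iUnion.2 ⟨a l.length, a, ?_, rfl⟩
    simp only [mem_ofPred_eq] at ha ⊢
    simp [PiNat.res_succ, ha]
  let M : Set X := ⋃ l, ((meagrePart (A l))ᶜ \ ⋃ n, (meagrePart (A (n :: l)))ᶜ)
  have hM : IsMeagre M := isMeagre_iUnion fun l => isMeagre_diff_envelope (hAsub l)
  have hnil : A [] = range f := by simp [A]
  have key : (meagrePart (A []))ᶜ \ M ⊆ range f := by
    rintro x ⟨hx, hxM⟩
    have step : ∀ l : {l // x ∈ (meagrePart (A l))ᶜ}, ∃ n, x ∈ (meagrePart (A (n :: l.1)))ᶜ := by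
      intro l
      by_contra! h
      exact hxM (mem_iUnion.2 ⟨l.1, l.2, fun h' => by
        obtain ⟨n, hn⟩ := mem_iUnion.1 h'
        exact h n hn⟩)
    choose nx hnx using step
    let L : ℕ → {l // x ∈ (meagrePart (A l))ᶜ} := fun k =>
      Nat.rec ⟨[], hx⟩ (fun _ l => ⟨nx l :: l.1, hnx l⟩) k
    let a : ℕ → ℕ := fun k => nx (L k)
    have hL : ∀ k, PiNat.res a k = (L k).1 := by
      intro k
      induction k with
      | zero => rfl
      | succ k ih => rw [PiNat.res_succ, ih]
    refine ⟨a, ?_⟩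
    by_contra hne
    obtain ⟨V, W, hV, hW, hfV, hxW, hVW⟩ := t2_separation hne
    have hnhds : f ⁻¹' V ∈ nhds a := (hV.preimage hf).mem_nhds hfV
    obtain ⟨k, hk⟩ : ∃ k, PiNat.cylinder a k ⊆ f ⁻¹' V := by
      obtain ⟨s, ⟨y, n, rfl⟩, has, hs⟩ :=
        (PiNat.isTopologicalBasis_cylinders (fun _ : ℕ => ℕ)).mem_nhds_iff.1 hnhds
      exact ⟨n, by rwa [PiNat.mem_cylinder_iff_eq.1 has]⟩
    have hcl := compl_meagrePart_subset_closure _ (L k).2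
    obtain ⟨_, hzW, b, hb, rfl⟩ := mem_closure_iff.1 hcl W hW hxW
    have hbV : b ∈ f ⁻¹' V := by
      apply hk
      rw [PiNat.cylinder_eq_res, mem_ofPred_eq]
      have h1 : (L k).1.length = k := by rw [← hL k, PiNat.res_length]
      rw [mem_ofPred_eq, h1] at hb
      rw [hb, hL k]
    exact disjoint_left.1 hVW hbV hzW
  borelize X
  refine (isOpen_meagrePart (A [])).measurableSet.compl.baireMeasurableSet.congr ?_
  have h2 : IsMeagre (A [] ∩ meagrePart (A [])) := isMeagre_inter_meagrePart _
  filter_upwards [hM, h2] with x hx1 hx2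
  apply propext
  constructor
  · exact fun h => key ⟨h, hx1⟩
  · intro h h'
    exact hx2 ⟨hnil ▸ h, not_not.1 fun h'' => h'' h'⟩

/-- A code for a subset of Cantor space depending only on an initial segment of coordinates. -/
abbrev CylCode : Type := Σ N : ℕ, Set (Fin N → Bool)

/-- The clopen set with a given code. -/
def cyl (c : CylCode) : Set (ℕ → Bool) := {g | (fun i : Fin c.1 => g i) ∈ c.2}

lemma isClopen_cyl (c : CylCode) : IsClopen (cyl c) :=
  (isClopen_discrete c.2).preimage (by fun_prop)

lemma measurableSet_cyl (c : CylCode) : MeasurableSet (cyl c) :=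
  (isClopen_cyl c).isOpen.measurableSet

lemma mem_cyl_of_agree {c : CylCode} {g h : ℕ → Bool} (hg : g ∈ cyl c)
    (hgh : ∀ n < c.1, g n = h n) : h ∈ cyl c := by
  have : (fun i : Fin c.1 => g i) = fun i : Fin c.1 => h i := funext fun i => hgh i i.2
  simpa only [cyl, mem_ofPred_eq, ← this] using hg

lemma exists_cyl_eq {N : ℕ} {C : Set (ℕ → Bool)}
    (hC : ∀ g ∈ C, ∀ h, (∀ n < N, g n = h n) → h ∈ C) : ∃ c, cyl c = C := by
  refine ⟨⟨N, (fun (g : ℕ → Bool) (i : Fin N) => g i) '' C⟩, ?_⟩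
  ext g
  constructor
  · rintro ⟨h, hh, hgh⟩
    exact hC h hh g fun n hn => congrFun hgh ⟨n, hn⟩
  · exact fun hg => ⟨g, hg, rfl⟩

/-- An open set is an increasing union of coded clopen sets. -/
lemma exists_cyl_monotone {O : Set (ℕ → Bool)} (hO : IsOpen O) :
    ∃ c : ℕ → CylCode, Monotone (fun k => cyl (c k)) ∧ ⋃ k, cyl (c k) = O := by
  have h : ∀ k, ∃ c, cyl c = {g | PiNat.cylinder g k ⊆ O} := fun k =>
    exists_cyl_eq (N := k) fun g hg h hgh => by
      rwa [mem_ofPred_eq, PiNat.mem_cylinder_iff_eq.1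
        (PiNat.mem_cylinder_iff.2 fun i hi => (hgh i hi).symm : h ∈ PiNat.cylinder g k)]
  choose c hc using h
  refine ⟨c, fun j k hjk => ?_, ?_⟩
  · simp only [hc]
    exact fun g hg => (PiNat.cylinder_anti g hjk).trans hg
  · simp only [hc]
    ext g
    rw [mem_iUnion]
    constructor
    · rintro ⟨k, hk⟩
      exact hk (PiNat.self_mem_cylinder g k)
    · intro hg
      obtain ⟨s, ⟨y, n, rfl⟩, hgs, hs⟩ :=
        (PiNat.isTopologicalBasis_cylinders (fun _ : ℕ => Bool)).mem_nhds_iff.1 (hO.mem_nhds hg)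
      exact ⟨n, by rwa [mem_ofPred_eq, PiNat.mem_cylinder_iff_eq.1 hgs]⟩

/-- A quantitative form of non-orthogonality: coded clopen sets of small `ν`-measure miss at
least `ε` of the mass of `μ`. -/
def Overlaps (ε : ℝ) (μ ν : Measure (ℕ → Bool)) : Prop :=
  ∃ k : ℕ, ∀ c, ν.real (cyl c) < 1 / ((k : ℝ) + 1) → μ.real (cyl c) ≤ 1 - ε

lemma Overlaps.of_le_add {ε ε' : ℝ} {μ μ' ν : Measure (ℕ → Bool)} (h : Overlaps ε μ ν)
    (hμ : ∀ c, μ'.real (cyl c) ≤ μ.real (cyl c) + (ε - ε')) : Overlaps ε' μ' ν := by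
  obtain ⟨k, hk⟩ := h
  exact ⟨k, fun c hc => by linarith [hμ c, hk c hc]⟩

lemma Overlaps.measure_le {ε : ℝ} {μ ν : Measure (ℕ → Bool)} [IsProbabilityMeasure μ]
    [IsProbabilityMeasure ν] (h : Overlaps ε μ ν) {B : Set (ℕ → Bool)} (hB : ν B = 0) :
    μ.real B ≤ 1 - ε := by
  obtain ⟨k, hk⟩ := h
  have hpos : (0 : ℝ) < 1 / ((k : ℝ) + 1) := by positivity
  obtain ⟨O, hBO, hO, hνO⟩ := B.exists_isOpen_lt_of_lt (μ := ν)
    (ENNReal.ofReal (1 / ((k : ℝ) + 1))) (by rw [hB]; exact ENNReal.ofReal_pos.2 hpos)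
  obtain ⟨c, hcm, hcO⟩ := exists_cyl_monotone hO
  have hsub : ∀ j, cyl (c j) ⊆ O := fun j => hcO ▸ subset_iUnion (fun j => cyl (c j)) j
  have h1 : ∀ j, μ.real (cyl (c j)) ≤ 1 - ε := fun j => hk _ <|
    (measureReal_mono (hsub j)).trans_lt
      ((ENNReal.lt_ofReal_iff_toReal_lt (measure_ne_top _ _)).1 hνO)
  have h2 : Tendsto (fun j => μ.real (cyl (c j))) atTop (nhds (μ.real O)) := by
    rw [← hcO]
    exact (ENNReal.tendsto_toReal (measure_ne_top _ _)).comp (tendsto_measure_iUnion_atTop hcm)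
  exact (measureReal_mono hBO).trans (le_of_tendsto' h2 h1)

lemma Overlaps.not_mutuallySingular {ε : ℝ} (hε : 0 < ε) {μ ν : Measure (ℕ → Bool)}
    [IsProbabilityMeasure μ] [IsProbabilityMeasure ν] (h : Overlaps ε μ ν) : ¬ μ ⟂ₘ ν := by
  rintro ⟨B, hB, hμB, hνB⟩
  have := h.measure_le hνB
  have h1 : μ.real Bᶜ = 1 := by
    rw [probReal_compl_eq_one_sub hB, measureReal_def, hμB]; simp
  linarith

lemma exists_overlaps {μ ν : Measure (ℕ → Bool)} [IsProbabilityMeasure μ]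
    [IsProbabilityMeasure ν] (h : ¬ μ ⟂ₘ ν) : ∃ m : ℕ, Overlaps ((1 / 2) ^ m) μ ν := by
  by_contra! hno
  have hc : ∀ m : ℕ, ∃ c, ν.real (cyl c) < (1 / 2 : ℝ) ^ m ∧
      1 - (1 / 2 : ℝ) ^ m < μ.real (cyl c) := by
    intro m
    have := hno m
    simp only [Overlaps, not_exists, not_forall, not_le] at this
    obtain ⟨k, hk⟩ := exists_nat_one_div_lt (show (0 : ℝ) < (1 / 2 : ℝ) ^ m by positivity)
    obtain ⟨c, hc, hc'⟩ := this k
    exact ⟨c, hc.trans hk, hc'⟩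
  choose c hνc hμc using hc
  have hsum : (∑' m : ℕ, ENNReal.ofReal ((1 / 2 : ℝ) ^ m)) ≠ ∞ := by
    rw [← ENNReal.ofReal_tsum_of_nonneg (fun _ => by positivity) summable_geometric_two]
    exact ENNReal.ofReal_ne_top
  have hsmall : ∀ (ρ : Measure (ℕ → Bool)) [IsProbabilityMeasure ρ] (s : ℕ → Set (ℕ → Bool)),
      (∀ m, ρ.real (s m) ≤ (1 / 2 : ℝ) ^ m) → ρ (limsup s atTop) = 0 := by
    intro ρ _ s hs
    refine measure_limsup_atTop_eq_zero
      (ne_top_of_le_ne_top hsum (ENNReal.tsum_le_tsum fun m => ?_))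
    rw [← ofReal_measureReal]
    exact ENNReal.ofReal_le_ofReal (hs m)
  have h1 := hsmall ν (fun m => cyl (c m)) fun m => (hνc m).le
  have h2 := hsmall μ (fun m => (cyl (c m))ᶜ) fun m => by
    rw [probReal_compl_eq_one_sub (measurableSet_cyl _)]
    linarith [hμc m]
  refine h (Measure.MutuallySingular.mk (s := limsup (fun m => (cyl (c m))ᶜ) atTop)
    (t := limsup (fun m => cyl (c m)) atTop) h2 h1 ?_)
  intro g _
  simp only [mem_union, mem_limsup_iff_frequently_mem, mem_compl_iff]
  by_cases hg : ∃ᶠ m in atTop, g ∉ cyl (c m)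
  · exact Or.inl hg
  · exact Or.inr ((not_frequently.1 hg).mono fun _ => not_not.1).frequently

/-- Only finitely many members of an orthogonal family overlap a given measure by `ε`. -/
lemma finite_overlaps {ε : ℝ} (hε : 0 < ε) {μ : Measure (ℕ → Bool)} [IsProbabilityMeasure μ]
    {S : Set (ProbabilityMeasure (ℕ → Bool))}
    (horth : ∀ ν ∈ S, ∀ ν' ∈ S, ν ≠ ν' →
      (ν : Measure (ℕ → Bool)) ⟂ₘ (ν' : Measure (ℕ → Bool)))
    (hS : ∀ ν ∈ S, Overlaps ε μ ν) : S.Finite := by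
  classical
  by_contra hinf
  obtain ⟨k, hk⟩ := exists_nat_gt (1 / ε)
  obtain ⟨T, hTS, hTk⟩ := Set.Infinite.exists_subset_card_eq hinf k
  have hsets : ∀ ν ν' : ProbabilityMeasure (ℕ → Bool), ∃ D : Set (ℕ → Bool), MeasurableSet D ∧
      (ν ∈ T → ν' ∈ T → ν ≠ ν' → (ν : Measure (ℕ → Bool)) D = 0 ∧
        (ν' : Measure (ℕ → Bool)) Dᶜ = 0) := by
    intro ν ν'
    by_cases hνν' : ν ∈ T ∧ ν' ∈ T ∧ ν ≠ ν'
    · obtain ⟨D, hD, h⟩ := horth ν (hTS hνν'.1) ν' (hTS hνν'.2.1) hνν'.2.2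
      exact ⟨D, hD, fun _ _ _ => h⟩
    · exact ⟨∅, MeasurableSet.empty, fun h1 h2 h3 => (hνν' ⟨h1, h2, h3⟩).elim⟩
  choose D hD hDnull using hsets
  let B : ProbabilityMeasure (ℕ → Bool) → Set (ℕ → Bool) := fun ν =>
    ⋂ ν' ∈ T.erase ν, ((D ν ν')ᶜ ∩ D ν' ν)
  have hBm : ∀ ν, MeasurableSet (B ν) := fun ν =>
    Finset.measurableSet_biInter _ fun ν' _ => (hD ν ν').compl.inter (hD ν' ν)
  have hBnull : ∀ ν ∈ T, (ν : Measure (ℕ → Bool)) (B ν)ᶜ = 0 := by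
    intro ν hν
    simp only [B, compl_iInter]
    refine (measure_biUnion_null_iff (T.erase ν).countable_toSet).2 fun ν' hν' => ?_
    obtain ⟨hne, hν'T⟩ := Finset.mem_erase.1 hν'
    rw [compl_inter, compl_compl]
    exact measure_union_null (hDnull ν ν' hν hν'T hne.symm).1 (hDnull ν' ν hν'T hν hne).2
  have hBdisj : (T : Set (ProbabilityMeasure (ℕ → Bool))).PairwiseDisjoint B := by
    intro ν hν ν' hν' hne
    refine disjoint_left.2 fun g hg hg' => ?_
    have h1 := mem_iInter₂.1 hg ν' (Finset.mem_erase.2 ⟨hne.symm, hν'⟩)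
    have h2 := mem_iInter₂.1 hg' ν (Finset.mem_erase.2 ⟨hne, hν⟩)
    exact h1.1 h2.2
  have hBge : ∀ ν ∈ T, ε ≤ μ.real (B ν) := by
    intro ν hν
    have h1 := (hS ν (hTS hν)).measure_le (hBnull ν hν)
    rw [probReal_compl_eq_one_sub (hBm ν)] at h1
    linarith
  have hsum : (k : ℝ) * ε ≤ 1 := by
    calc (k : ℝ) * ε = ∑ _ν ∈ T, ε := by rw [Finset.sum_const, hTk, nsmul_eq_mul]
      _ ≤ ∑ ν ∈ T, μ.real (B ν) := Finset.sum_le_sum hBge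
      _ = μ.real (⋃ ν ∈ T, B ν) := (measureReal_biUnion_finset hBdisj fun ν _ => hBm ν).symm
      _ ≤ 1 := measureReal_le_one
  rw [div_lt_iff₀ hε] at hk
  linarith

/-- A member of a finite orthogonal family is separated from the others by a coded clopen set. -/
lemma exists_cyl_separating {T : Set (ProbabilityMeasure (ℕ → Bool))} (hT : T.Finite)
    {ν : ProbabilityMeasure (ℕ → Bool)}
    (horth : ∀ ν' ∈ T, ν' ≠ ν → (ν : Measure (ℕ → Bool)) ⟂ₘ (ν' : Measure (ℕ → Bool))) :
    ∃ c, 1 / 2 < (ν : Measure (ℕ → Bool)).real (cyl c) ∧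
      ∀ ν' ∈ T, ν' ≠ ν → (ν' : Measure (ℕ → Bool)).real (cyl c) ≤ 1 / 2 := by
  classical
  let F := hT.toFinset.erase ν
  let σ : Measure (ℕ → Bool) := ∑ ν' ∈ F, (ν' : Measure (ℕ → Bool))
  have hle : ∀ ν' ∈ F, (ν' : Measure (ℕ → Bool)) ≤ σ := fun ν' hν' =>
    Finset.single_le_sum (f := fun ν' : ProbabilityMeasure (ℕ → Bool) => (ν' : Measure (ℕ → Bool)))
      (fun _ _ => Measure.zero_le _) hν'
  have hperp : (ν : Measure (ℕ → Bool)) ⟂ₘ σ := by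
    have : σ = Measure.sum fun ν' : F =>
        ((ν' : ProbabilityMeasure (ℕ → Bool)) : Measure (ℕ → Bool)) := by
      rw [Measure.sum_fintype]
      exact (Finset.sum_coe_sort F
        fun ν' : ProbabilityMeasure (ℕ → Bool) => (ν' : Measure (ℕ → Bool))).symm
    rw [this, Measure.MutuallySingular.sum_right]
    intro ν'
    obtain ⟨hne, hν'⟩ := Finset.mem_erase.1 ν'.2
    exact horth ν' (hT.mem_toFinset.1 hν') hne
  obtain ⟨B, hB, hνB, hσB⟩ := hperp
  obtain ⟨O, hBO, hO, hσO⟩ := Bᶜ.exists_isOpen_lt_of_lt (μ := σ) (1 / 2)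
    (by rw [hσB]; norm_num)
  obtain ⟨c, hcm, hcO⟩ := exists_cyl_monotone hO
  have hνO : (ν : Measure (ℕ → Bool)).real O = 1 := by
    refine le_antisymm measureReal_le_one ?_
    have h1 : (ν : Measure (ℕ → Bool)).real Bᶜ = 1 := by
      rw [probReal_compl_eq_one_sub hB, measureReal_def, hνB]; simp
    exact h1 ▸ measureReal_mono hBO
  have h2 : Tendsto (fun j => (ν : Measure (ℕ → Bool)).real (cyl (c j))) atTop (nhds 1) := by
    rw [← hνO, ← hcO]
    exact (ENNReal.tendsto_toReal (measure_ne_top _ _)).comp (tendsto_measure_iUnion_atTop hcm)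
  obtain ⟨j, hj⟩ := (h2.eventually_const_lt (show (1 / 2 : ℝ) < 1 by norm_num)).exists
  refine ⟨c j, hj, fun ν' hν' hne => ?_⟩
  have hsub : cyl (c j) ⊆ O := hcO ▸ subset_iUnion (fun j => cyl (c j)) j
  have h3 : (ν' : Measure (ℕ → Bool)) (cyl (c j)) ≤ 1 / 2 :=
    ((hle ν' (Finset.mem_erase.2 ⟨hne, hT.mem_toFinset.2 hν'⟩) _).trans (measure_mono hsub)).trans
      hσO.le
  simpa [measureReal_def] using ENNReal.toReal_mono (by norm_num) h3

/-- The infinite product of Lebesgue measure on the unit interval. -/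
def cubeMeasure : Measure (ℕ → unitInterval) := Measure.infinitePi fun _ => volume

instance : IsProbabilityMeasure cubeMeasure := by
  unfold cubeMeasure; infer_instance

/-- Compare each coordinate of `u` with the threshold `x`. -/
def threshold (x : ℕ → ℝ) (u : ℕ → unitInterval) (n : ℕ) : Bool :=
  decide ((u n : ℝ) < x n)

lemma measurable_threshold (x : ℕ → ℝ) : Measurable (threshold x) := by
  refine measurable_pi_lambda _ fun n => measurable_to_bool ?_
  have : (fun u => threshold x u n) ⁻¹' {true} = {u : ℕ → unitInterval | (u n : ℝ) < x n} := by
    ext u; simp [threshold]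
  rw [this]
  exact measurableSet_lt (by fun_prop) measurable_const

/-- The product of Bernoulli measures in which coordinate `n` is `true` with probability `x n`
(truncated to the unit interval). -/
def bernoulliProd (x : ℕ → ℝ) : Measure (ℕ → Bool) := cubeMeasure.map (threshold x)

instance (x : ℕ → ℝ) : IsProbabilityMeasure (bernoulliProd x) :=
  Measure.isProbabilityMeasure_map (measurable_threshold x).aemeasurable

lemma cubeMeasure_threshold_ne_le (x y : ℕ → ℝ) (n : ℕ) :
    cubeMeasure {u | threshold x u n ≠ threshold y u n} ≤ ENNReal.ofReal |x n - y n| := by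
  let S : Set unitInterval := Subtype.val ⁻¹' Icc (min (x n) (y n)) (max (x n) (y n))
  have hS : MeasurableSet S := measurable_subtype_coe measurableSet_Icc
  have hsub : {u | threshold x u n ≠ threshold y u n} ⊆
      (Function.eval n : (ℕ → unitInterval) → unitInterval) ⁻¹' S := by
    intro u hu
    simp only [threshold, mem_ofPred_eq, ne_eq, decide_eq_decide] at hu
    simp only [S, mem_preimage, Function.eval, mem_Icc, min_le_iff, le_max_iff]
    rcases lt_or_ge (u n : ℝ) (x n) with h1 | h1 <;> rcases lt_or_ge (u n : ℝ) (y n) with h2 | h2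
    · exact (hu (iff_of_true h1 h2)).elim
    · exact ⟨Or.inr h2, Or.inl h1.le⟩
    · exact ⟨Or.inl h1, Or.inr h2.le⟩
    · exact (hu (iff_of_false h1.not_gt h2.not_gt)).elim
  calc cubeMeasure {u | threshold x u n ≠ threshold y u n}
      ≤ cubeMeasure (Function.eval n ⁻¹' S) := measure_mono hsub
    _ = volume S := (measurePreserving_eval_infinitePi
        (fun _ : ℕ => (volume : Measure unitInterval)) n).measure_preimage hS.nullMeasurableSet
    _ ≤ volume (Icc (min (x n) (y n)) (max (x n) (y n))) := by
        rw [unitInterval.volume_apply]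
        exact measure_mono (image_preimage_subset _ _)
    _ = ENNReal.ofReal |x n - y n| := by rw [Real.volume_Icc, max_sub_min_eq_abs']

/-- Coupling bound for changing the parameters of a product of Bernoulli measures. -/
lemma bernoulliProd_le_add {x y : ℕ → ℝ} {s : Finset ℕ} {C : Set (ℕ → Bool)}
    (hC : MeasurableSet C)
    (h : ∀ u, threshold y u ∈ C → (∀ n ∈ s, threshold x u n = threshold y u n) →
      threshold x u ∈ C) :
    (bernoulliProd y).real C ≤ (bernoulliProd x).real C + ∑ n ∈ s, |x n - y n| := by
  have hsub : threshold y ⁻¹' C ⊆ threshold x ⁻¹' C ∪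
      ⋃ n ∈ s, {u | threshold x u n ≠ threshold y u n} := by
    intro u hu
    by_cases hx : ∀ n ∈ s, threshold x u n = threshold y u n
    · exact Or.inl (h u hu hx)
    · push Not at hx
      obtain ⟨n, hn, hne⟩ := hx
      exact Or.inr (mem_biUnion (t := fun n => {u | threshold x u n ≠ threshold y u n}) hn hne)
  have hmain : bernoulliProd y C ≤
      bernoulliProd x C + ENNReal.ofReal (∑ n ∈ s, |x n - y n|) := by
    rw [bernoulliProd, bernoulliProd, Measure.map_apply (measurable_threshold y) hC,
      Measure.map_apply (measurable_threshold x) hC,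
      ENNReal.ofReal_sum_of_nonneg fun _ _ => abs_nonneg _]
    refine (measure_mono hsub).trans ((measure_union_le _ _).trans ?_)
    gcongr
    exact (measure_biUnion_finset_le _ _).trans
      (Finset.sum_le_sum fun n _ => cubeMeasure_threshold_ne_le x y n)
  have hnn : 0 ≤ ∑ n ∈ s, |x n - y n| := Finset.sum_nonneg fun _ _ => abs_nonneg _
  have := ENNReal.toReal_mono (by finiteness) hmain
  rwa [ENNReal.toReal_add (by finiteness) (by finiteness), ENNReal.toReal_ofReal hnn] at this

/-- Moving finitely many parameters changes the measure of every coded set by at most the total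
displacement. -/
lemma bernoulliProd_le_add_of_finite {x y : ℕ → ℝ} {s : Finset ℕ} (h : ∀ n ∉ s, x n = y n)
    (c : CylCode) :
    (bernoulliProd y).real (cyl c) ≤ (bernoulliProd x).real (cyl c) + ∑ n ∈ s, |x n - y n| := by
  refine bernoulliProd_le_add (measurableSet_cyl c) fun u hu hs => ?_
  have : threshold x u = threshold y u := by
    funext n
    by_cases hn : n ∈ s
    · exact hs n hn
    · simp [threshold, h n hn]
  rwa [this]

lemma continuous_bernoulliProd (c : CylCode) :
    Continuous fun x => (bernoulliProd x).real (cyl c) := by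
  have hle : ∀ x y, (bernoulliProd y).real (cyl c) ≤
      (bernoulliProd x).real (cyl c) + ∑ n ∈ Finset.range c.1, |x n - y n| := fun x y =>
    bernoulliProd_le_add (measurableSet_cyl c) fun u hu hs =>
      mem_cyl_of_agree hu fun n hn => (hs n (Finset.mem_range.2 hn)).symm
  refine continuous_iff_continuousAt.2 fun x => ?_
  have hlim : Tendsto (fun y : ℕ → ℝ => ∑ n ∈ Finset.range c.1, |x n - y n|) (nhds x) (nhds 0) := by
    have : Continuous fun y : ℕ → ℝ => ∑ n ∈ Finset.range c.1, |x n - y n| := by fun_prop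
    simpa using this.tendsto x
  refine tendsto_iff_dist_tendsto_zero.2 (squeeze_zero (fun _ => dist_nonneg) (fun y => ?_) hlim)
  have hsymm : ∑ n ∈ Finset.range c.1, |y n - x n| = ∑ n ∈ Finset.range c.1, |x n - y n| :=
    Finset.sum_congr rfl fun n _ => abs_sub_comm _ _
  have h1 := hle x y
  have h2 := hle y x
  rw [hsymm] at h2
  rw [Real.dist_eq, abs_le]
  constructor <;> linarith

/-- The parameters whose product measure is orthogonal to a given measure are dense. -/
lemma dense_mutuallySingular (ν : Measure (ℕ → Bool)) [IsProbabilityMeasure ν] :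
    Dense {x | bernoulliProd x ⟂ₘ ν} := by
  rw [dense_iff_inter_open]
  rintro U hU ⟨x, hx⟩
  obtain ⟨s, ⟨y, N, rfl⟩, hxs, hs⟩ : ∃ s, (∃ (y : ℕ → ℝ) (N : ℕ), s = {z | ∀ n < N, z n = y n}) ∧
      x ∈ s ∧ s ⊆ U := by
    obtain ⟨I, u, hu, hIU⟩ := isOpen_pi_iff.1 hU x hx
    refine ⟨_, ⟨x, I.sup id + 1, rfl⟩, fun _ _ => rfl, fun z hz => hIU fun i hi => ?_⟩
    rw [hz i (Nat.lt_succ_of_le (Finset.le_sup (f := id) hi))]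
    exact (hu i hi).2
  let T : (ℕ → Bool) → Set (ℕ → Bool) := fun z => {g | ∀ n, g (n + N) = z n}
  have hTm : ∀ z, MeasurableSet (T z) := fun z => by
    have : T z = ⋂ n, {g | g (n + N) = z n} := by ext; simp [T]
    rw [this]
    exact MeasurableSet.iInter fun n => measurableSet_eq_fun (by fun_prop) measurable_const
  have hcount : {z | 0 < ν (T z)}.Countable := by
    refine Measure.countable_meas_pos_of_disjoint_iUnion hTm fun z z' hne => ?_
    exact disjoint_left.2 fun g hg hg' => hne (funext fun n => (hg n).symm.trans (hg' n))
  obtain ⟨z, hz⟩ : ∃ z, z ∉ {z | 0 < ν (T z)} := by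
    by_contra! hall
    have : (univ : Set (ℕ → Bool)).Countable := hcount.mono fun z _ => hall z
    have hc := countable_univ_iff.1 this
    obtain ⟨f, hf⟩ := exists_surjective_nat (ℕ → Bool)
    obtain ⟨n, hn⟩ := hf fun n => !f n n
    simpa using congrFun hn n
  let w : ℕ → ℝ := fun n => if n < N then x n else if z (n - N) then 2 else -1
  refine ⟨w, hs fun n hn => ?_, ?_⟩
  · simp only [w, if_pos hn]
    exact hxs n hn
  · refine Measure.MutuallySingular.mk (s := (T z)ᶜ) (t := T z) ?_ (by simpa using hz) (by simp)
    rw [bernoulliProd, Measure.map_apply (measurable_threshold w) (hTm z).compl]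
    convert measure_empty (μ := cubeMeasure)
    ext u
    simp only [mem_preimage, mem_compl_iff, mem_empty_iff_false, iff_false, not_not]
    intro n
    have h0 := (u (n + N)).2.1
    have h1 := (u (n + N)).2.2
    cases hzn : z n
    · simp [threshold, w, hzn]; linarith
    · simp [threshold, w, hzn]; linarith

/-- A generic product measure does not overlap a given measure by a fixed amount. -/
lemma isMeagre_overlaps {ε : ℝ} (hε : 0 < ε) (ν : Measure (ℕ → Bool)) [IsProbabilityMeasure ν] :
    IsMeagre {x | Overlaps ε (bernoulliProd x) ν} := by
  have hG : IsGδ {x | ¬ Overlaps ε (bernoulliProd x) ν} := by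
    have : {x | ¬ Overlaps ε (bernoulliProd x) ν} = ⋂ k : ℕ,
        ⋃ c ∈ {c | ν.real (cyl c) < 1 / ((k : ℝ) + 1)},
          {x | 1 - ε < (bernoulliProd x).real (cyl c)} := by
      ext x
      simp [Overlaps]
    rw [this]
    exact IsGδ.iInter_of_isOpen fun k => isOpen_biUnion fun c _ =>
      isOpen_lt continuous_const (continuous_bernoulliProd c)
  refine residual_of_dense_Gδ hG ((dense_mutuallySingular ν).mono fun x hx hx' => ?_)
  exact hx'.not_mutuallySingular hε hx

lemma eventually_add_notMem {M : Set (ℕ → ℝ)} (hM : IsMeagre M) (v : ℕ → ℝ) :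
    ∀ᶠ x in residual (ℕ → ℝ), x + v ∉ M :=
  hM.preimage_of_isOpenMap (Homeomorph.addRight v).continuous (Homeomorph.addRight v).isOpenMap

/-- A zero-one law: a set with the property of Baire that is, inside a generic subset of a convex
open set, invariant under small finitely supported translations is meagre or comeagre there. -/
lemma isMeagre_or_of_translation_invariant {U G S : Set (ℕ → ℝ)} {δ : ℝ} (hδ : 0 < δ)
    (hU : IsOpen U) (hUc : Convex ℝ U) (hUG : IsMeagre (U \ G)) (hS : BaireMeasurableSet S)
    (hinv : ∀ x ∈ G, ∀ y ∈ G, ∀ s : Finset ℕ, (∀ n ∉ s, x n = y n) →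
      ∑ n ∈ s, |x n - y n| ≤ δ → x ∈ S → y ∈ S) :
    IsMeagre (U ∩ S) ∨ IsMeagre (U \ S) := by
  obtain ⟨O, hO, hSO⟩ := hS.residualEq_isOpen
  obtain ⟨O', hO', hSO'⟩ := hS.compl.residualEq_isOpen
  have hOS : IsMeagre (O \ S) := by
    filter_upwards [hSO] with x hx hx'
    exact hx'.2 ((show (x ∈ S) = (x ∈ O) from hx).symm ▸ hx'.1)
  have hO'S : IsMeagre (O' ∩ S) := by
    filter_upwards [hSO'] with x hx hx'
    exact ((show (x ∈ Sᶜ) = (x ∈ O') from hx).symm ▸ hx'.1 : x ∈ Sᶜ) hx'.2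
  rcases (U ∩ O).eq_empty_or_nonempty with h | ⟨x', hx'U, hx'O⟩
  · left
    filter_upwards [hSO] with x hx hx'
    have : x ∈ O := (show (x ∈ S) = (x ∈ O) from hx) ▸ hx'.2
    exact h.subset ⟨hx'.1, this⟩
  rcases (U ∩ O').eq_empty_or_nonempty with h | ⟨y', hy'⟩
  · right
    filter_upwards [hSO'] with x hx hx'
    have : x ∈ O' := (show (x ∈ Sᶜ) = (x ∈ O') from hx) ▸ hx'.2
    exact h.subset ⟨hx'.1, this⟩
  exfalso
  classical
  obtain ⟨I, u, hu, hIU⟩ := isOpen_pi_iff.1 (hU.inter hO') y' hy'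
  let v : ℕ → ℝ := fun n => if n ∈ I then y' n - x' n else 0
  have hv : ∀ n ∉ I, v n = 0 := fun n hn => if_neg hn
  have hx'v : x' + v ∈ U ∩ O' := by
    refine hIU fun n hn => ?_
    have hn' : n ∈ I := hn
    have : (x' + v) n = y' n := by simp [v, hn']
    rw [this]
    exact (hu n hn').2
  obtain ⟨k, hk⟩ := exists_nat_gt ((∑ n ∈ I, |v n|) / δ)
  have hk0 : (0 : ℝ) < k := lt_of_le_of_lt (by positivity) hk
  let p : (ℕ → ℝ) → ℕ → (ℕ → ℝ) := fun x i => x + ((i : ℝ) / k) • v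
  have hp0 : ∀ x, p x 0 = x := fun x => by simp [p]
  have hpk : ∀ x, p x k = x + v := fun x => by simp [p, div_self hk0.ne']
  have hW : IsOpen ((U ∩ O) ∩ {x | x + v ∈ U ∩ O'}) :=
    (hU.inter hO).inter ((hU.inter hO').preimage (by fun_prop : Continuous fun x => x + v))
  have hgen : ∀ᶠ x in residual (ℕ → ℝ), (∀ i : ℕ, p x i ∉ U \ G) ∧ x ∉ O \ S ∧ x + v ∉ O' ∩ S :=
    (eventually_countable_forall.2 fun i => eventually_add_notMem hUG _).and
      (Filter.Eventually.and hOS (eventually_add_notMem hO'S v))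
  obtain ⟨x, ⟨⟨hxU, hxO⟩, hxvU, hxvO⟩, hxG, hxS, hxvS⟩ :=
    (dense_of_mem_residual hgen).inter_open_nonempty _ hW ⟨x', ⟨hx'U, hx'O⟩, hx'v⟩
  have hpG : ∀ i ≤ k, p x i ∈ G := by
    intro i hi
    have hpU : p x i ∈ U := by
      refine hUc.add_smul_mem hxU hxvU ⟨by positivity, ?_⟩
      rw [div_le_one hk0]
      exact_mod_cast hi
    by_contra hG
    exact hxG i ⟨hpU, hG⟩
  have hpS : ∀ i ≤ k, p x i ∈ S := by
    intro i
    induction i with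
    | zero =>
      intro _
      rw [hp0]
      by_contra h
      exact hxS ⟨hxO, h⟩
    | succ i ih =>
      intro hi
      have hdiff : ∀ n, p x i n - p x (i + 1) n = -(v n / k) := fun n => by
        simp only [p, Pi.add_apply, Pi.smul_apply, smul_eq_mul]
        push_cast
        ring
      refine hinv _ (hpG i (by omega)) _ (hpG (i + 1) hi) I (fun n hn => ?_) ?_ (ih (by omega))
      · have := hdiff n
        rw [hv n hn] at this
        simp only [zero_div, neg_zero] at this
        linarith
      · calc ∑ n ∈ I, |p x i n - p x (i + 1) n| = (∑ n ∈ I, |v n|) / k := by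
              rw [Finset.sum_div]
              refine Finset.sum_congr rfl fun n _ => ?_
              rw [hdiff, abs_neg, abs_div, abs_of_pos hk0]
          _ ≤ δ := by
              rw [div_le_iff₀ hk0]
              rw [div_lt_iff₀ hδ] at hk
              linarith
  exact hxvS ⟨hxvO, hpk x ▸ hpS k le_rfl⟩

lemma continuous_measureReal_cyl (c : CylCode) :
    Continuous fun ν : ProbabilityMeasure (ℕ → Bool) => (ν : Measure (ℕ → Bool)).real (cyl c) := by
  refine continuous_iff_continuousAt.2 fun ν => ?_
  refine (ENNReal.tendsto_toReal (measure_ne_top _ _)).comp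
    (ProbabilityMeasure.tendsto_measure_of_null_frontier_of_tendsto' tendsto_id ?_)
  rw [(isClopen_cyl c).frontier_eq, measure_empty]

lemma measurableSet_overlaps {Z : Type*} [TopologicalSpace Z] [MeasurableSpace Z]
    [OpensMeasurableSpace Z] (ε : ℝ) {x : Z → ℕ → ℝ} (hx : Continuous x)
    {ν : Z → ProbabilityMeasure (ℕ → Bool)} (hν : Continuous ν) :
    MeasurableSet {z | Overlaps ε (bernoulliProd (x z)) (ν z : Measure (ℕ → Bool))} := by
  have h1 : ∀ c, Continuous fun z => (ν z : Measure (ℕ → Bool)).real (cyl c) := fun c =>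
    (continuous_measureReal_cyl c).comp hν
  have h2 : ∀ c, Continuous fun z => (bernoulliProd (x z)).real (cyl c) := fun c =>
    (continuous_bernoulliProd c).comp hx
  have : {z | Overlaps ε (bernoulliProd (x z)) (ν z : Measure (ℕ → Bool))} = ⋃ k : ℕ, ⋂ c,
      ({z | (ν z : Measure (ℕ → Bool)).real (cyl c) < 1 / ((k : ℝ) + 1)}ᶜ ∪
        {z | (bernoulliProd (x z)).real (cyl c) ≤ 1 - ε}) := by
    ext z
    simp only [Overlaps, mem_ofPred_eq, mem_iUnion, mem_iInter, mem_union, mem_compl_iff,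
      ← imp_iff_not_or]
  rw [this]
  exact MeasurableSet.iUnion fun k => MeasurableSet.iInter fun c =>
    (isOpen_lt (h1 c) continuous_const).measurableSet.compl.union
      (isClosed_le (h2 c) continuous_const).measurableSet

lemma analyticSet_exists {X Z : Type*} [TopologicalSpace X] [PolishSpace X] [MeasurableSpace X]
    [BorelSpace X] [TopologicalSpace Z] [PolishSpace Z] [MeasurableSpace Z] [BorelSpace Z]
    {p : X × Z → Prop} (hp : MeasurableSet {w | p w}) : AnalyticSet {x | ∃ z, p (x, z)} := by
  have : {x | ∃ z, p (x, z)} = Prod.fst '' {w | p w} := by ext; simp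
  rw [this]
  exact hp.analyticSet.image_of_continuous continuous_fst

section Selection

variable (f : (ℕ → ℕ) → ProbabilityMeasure (ℕ → Bool)) (c : CylCode)

/-- The point `a` codes a measure that charges `cyl c` and overlaps `bernoulliProd x` by `ε`. -/
def Selects (ε : ℝ) (x : ℕ → ℝ) (a : ℕ → ℕ) : Prop :=
  1 / 2 < (f a : Measure (ℕ → Bool)).real (cyl c) ∧
    Overlaps ε (bernoulliProd x) (f a : Measure (ℕ → Bool))

/-- The parameters `x` at which some measure is selected at level `ε`, and no two different
measures are selected at level `ε / 2`. -/
def selectionDomain (ε : ℝ) : Set (ℕ → ℝ) :=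
  {x | ∃ a, Selects f c ε x a} \
    {x | ∃ p : (ℕ → ℕ) × (ℕ → ℕ), f p.1 ≠ f p.2 ∧ Selects f c (ε / 2) x p.1 ∧
      Selects f c (ε / 2) x p.2}

variable {f c}

lemma Selects.of_le_add {ε ε' : ℝ} {x y : ℕ → ℝ} {a : ℕ → ℕ} (h : Selects f c ε x a)
    {s : Finset ℕ} (hs : ∀ n ∉ s, x n = y n) (hxy : ∑ n ∈ s, |x n - y n| ≤ ε - ε') :
    Selects f c ε' y a :=
  ⟨h.1, h.2.of_le_add fun d => (bernoulliProd_le_add_of_finite hs d).trans (by linarith)⟩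

lemma eq_of_selects {ε : ℝ} {x : ℕ → ℝ} (hx : x ∈ selectionDomain f c ε) {a b : ℕ → ℕ}
    (ha : Selects f c (ε / 2) x a) (hb : Selects f c (ε / 2) x b) : f a = f b := by
  by_contra hne
  exact hx.2 ⟨(a, b), hne, ha, hb⟩

lemma measurableSet_selects {Z : Type*} [TopologicalSpace Z] [MeasurableSpace Z]
    [OpensMeasurableSpace Z] (hf : Continuous f) (ε : ℝ) {x : Z → ℕ → ℝ} (hx : Continuous x)
    {a : Z → ℕ → ℕ} (ha : Continuous a) : MeasurableSet {z | Selects f c ε (x z) (a z)} :=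
  (isOpen_lt continuous_const
    ((continuous_measureReal_cyl c).comp (hf.comp ha))).measurableSet.inter
      (measurableSet_overlaps ε hx (hf.comp ha))

lemma baireMeasurableSet_selectionDomain (hf : Continuous f) (ε : ℝ) :
    BaireMeasurableSet (selectionDomain f c ε) := by
  refine BaireMeasurableSet.diff ?_ ?_
  · exact AnalyticSet.baireMeasurableSet (analyticSet_exists (p := fun w => Selects f c ε w.1 w.2)
      (measurableSet_selects hf ε continuous_fst continuous_snd))
  · refine AnalyticSet.baireMeasurableSet (analyticSet_exists (Z := (ℕ → ℕ) × (ℕ → ℕ))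
      (p := fun w => f w.2.1 ≠ f w.2.2 ∧ Selects f c (ε / 2) w.1 w.2.1 ∧
        Selects f c (ε / 2) w.1 w.2.2) ?_)
    refine MeasurableSet.inter ?_ (MeasurableSet.inter ?_ ?_)
    · exact (isOpen_ne_fun (by fun_prop) (by fun_prop)).measurableSet
    · exact measurableSet_selects hf _ continuous_fst (by fun_prop)
    · exact measurableSet_selects hf _ continuous_fst (by fun_prop)

/-- The selection domain is not comeagre in a nonempty convex open set: by the zero-one
law the selected measure would be generically constant there. -/
lemma not_isMeagre_diff_selectionDomain (hf : Continuous f) {ε : ℝ} (hε : 0 < ε)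
    {U : Set (ℕ → ℝ)} (hU : IsOpen U) (hUc : Convex ℝ U) (hUne : U.Nonempty) :
    ¬ IsMeagre (U \ selectionDomain f c ε) := by
  intro hUG
  let S : CylCode × ℚ → Set (ℕ → ℝ) := fun d =>
    {x | ∃ a, Selects f c ε x a ∧ (d.2 : ℝ) < (f a : Measure (ℕ → Bool)).real (cyl d.1)}
  have hSB : ∀ d, BaireMeasurableSet (S d) := fun d =>
    AnalyticSet.baireMeasurableSet (analyticSet_exists
      (p := fun w => Selects f c ε w.1 w.2 ∧
        (d.2 : ℝ) < (f w.2 : Measure (ℕ → Bool)).real (cyl d.1))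
      ((measurableSet_selects hf ε continuous_fst continuous_snd).inter
        (isOpen_lt continuous_const
          ((continuous_measureReal_cyl d.1).comp (hf.comp continuous_snd))).measurableSet))
  have hzo : ∀ d, IsMeagre (U ∩ S d) ∨ IsMeagre (U \ S d) := by
    refine fun d => isMeagre_or_of_translation_invariant (half_pos hε) hU hUc hUG (hSB d) ?_
    rintro x - y hy s hs hxy ⟨a, ha, had⟩
    obtain ⟨b, hb⟩ := hy.1
    have hyb : Selects f c (ε / 2) y b :=
      hb.of_le_add (s := ∅) (fun _ _ => rfl) (by simpa using hε.le)
    have hya : Selects f c (ε / 2) y a := ha.of_le_add hs (by linarith)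
    exact ⟨b, hb, eq_of_selects hy hya hyb ▸ had⟩
  have hdec : ∀ d, ∃ P : Prop, ∀ᶠ x in residual (ℕ → ℝ), x ∈ U → (x ∈ S d ↔ P) := by
    intro d
    rcases hzo d with h | h
    · refine ⟨False, ?_⟩
      filter_upwards [h] with x hx hxU
      exact iff_of_false (fun hxS => hx ⟨hxU, hxS⟩) id
    · refine ⟨True, ?_⟩
      filter_upwards [h] with x hx hxU
      refine iff_of_true ?_ trivial
      by_contra hxS
      exact hx ⟨hxU, hxS⟩
  choose P hP using hdec
  have hgen : ∀ᶠ x in residual (ℕ → ℝ), x ∈ U → x ∈ selectionDomain f c ε ∧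
      ∀ d, x ∈ S d ↔ P d := by
    filter_upwards [hUG, eventually_countable_forall.2 hP] with x hx hx' hxU
    refine ⟨?_, fun d => hx' d hxU⟩
    by_contra hxG
    exact hx ⟨hxU, hxG⟩
  have hSiff : ∀ x ∈ selectionDomain f c ε, ∀ a, Selects f c ε x a → ∀ d,
      (x ∈ S d ↔ (d.2 : ℝ) < (f a : Measure (ℕ → Bool)).real (cyl d.1)) := by
    intro x hx a ha d
    refine ⟨?_, fun h => ⟨a, ha, h⟩⟩
    rintro ⟨b, hb, hbd⟩
    have hhalf : ∀ e, Selects f c ε x e → Selects f c (ε / 2) x e := fun e he =>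
      he.of_le_add (s := ∅) (fun _ _ => rfl) (by simpa using hε.le)
    exact eq_of_selects hx (hhalf b hb) (hhalf a ha) ▸ hbd
  obtain ⟨x₀, hx₀U, hx₀⟩ := (dense_of_mem_residual hgen).inter_open_nonempty U hU hUne
  obtain ⟨hx₀G, hx₀P⟩ := hx₀ hx₀U
  obtain ⟨a₀, ha₀⟩ := hx₀G.1
  have hover : ∀ᶠ x in residual (ℕ → ℝ), x ∈ U →
      Overlaps ε (bernoulliProd x) (f a₀ : Measure (ℕ → Bool)) := by
    filter_upwards [hgen] with x hx hxU
    obtain ⟨hxG, hxP⟩ := hx hxU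
    obtain ⟨a, ha⟩ := hxG.1
    have heq : ∀ d, (f a : Measure (ℕ → Bool)).real (cyl d) =
        (f a₀ : Measure (ℕ → Bool)).real (cyl d) := by
      refine fun d => eq_of_forall_rat_lt_iff_lt fun q => ?_
      rw [← hSiff x hxG a ha (d, q), ← hSiff x₀ hx₀G a₀ ha₀ (d, q), hxP, hx₀P]
    obtain ⟨k, hk⟩ := ha.2
    exact ⟨k, fun d hd => hk d (heq d ▸ hd)⟩
  obtain ⟨x, hxU, hx, hx'⟩ := (dense_of_mem_residual (hover.and
    (isMeagre_overlaps hε (f a₀ : Measure (ℕ → Bool))))).inter_open_nonempty U hU hUne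
  exact hx' (hx hxU)

/-- If the range of `f` is an orthogonal family meeting every product measure, then the selection
domains cover the parameter space. -/
lemma exists_mem_selectionDomain
    (horth : ∀ a b, f a ≠ f b → (f a : Measure (ℕ → Bool)) ⟂ₘ (f b : Measure (ℕ → Bool)))
    {x : ℕ → ℝ} {a : ℕ → ℕ} (ha : ¬ bernoulliProd x ⟂ₘ (f a : Measure (ℕ → Bool))) :
    ∃ (c : CylCode) (m : ℕ), x ∈ selectionDomain f c ((1 / 2) ^ m) := by
  obtain ⟨m, hm⟩ := exists_overlaps ha
  have hpos : (0 : ℝ) < (1 / 2) ^ m / 2 := by positivity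
  let T : Set (ProbabilityMeasure (ℕ → Bool)) :=
    {ν | ν ∈ range f ∧ Overlaps ((1 / 2) ^ m / 2) (bernoulliProd x) (ν : Measure (ℕ → Bool))}
  have hT : T.Finite := by
    refine finite_overlaps hpos (μ := bernoulliProd x) ?_ fun ν hν => hν.2
    rintro _ ⟨⟨b, rfl⟩, -⟩ _ ⟨⟨b', rfl⟩, -⟩ hne
    exact horth b b' hne
  obtain ⟨c, hc, hcT⟩ := exists_cyl_separating hT (ν := f a) (by
    rintro _ ⟨⟨b, rfl⟩, -⟩ hne
    exact horth a b hne.symm)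
  refine ⟨c, m, ⟨a, hc, hm⟩, ?_⟩
  rintro ⟨⟨b, b'⟩, hne, hb, hb'⟩
  have heq : ∀ e, Selects f c ((1 / 2) ^ m / 2) x e → f e = f a := fun e he => by
    by_contra hea
    exact (hcT (f e) ⟨⟨e, rfl⟩, he.2⟩ hea).not_gt he.1
  exact hne ((heq b hb).trans (heq b' hb').symm)

end Selection

lemma exists_convex_open_of_not_isMeagre {S : Set (ℕ → ℝ)} (hS : BaireMeasurableSet S)
    (h : ¬ IsMeagre S) : ∃ U, IsOpen U ∧ Convex ℝ U ∧ U.Nonempty ∧ IsMeagre (U \ S) := by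
  obtain ⟨O, hO, hSO⟩ := hS.residualEq_isOpen
  have hOne : O.Nonempty := by
    rw [nonempty_iff_ne_empty]
    rintro rfl
    refine h ?_
    filter_upwards [hSO] with x hx hxS
    exact ((show (x ∈ S) = (x ∈ (∅ : Set (ℕ → ℝ))) from hx) ▸ hxS : x ∈ (∅ : Set (ℕ → ℝ)))
  obtain ⟨x, hx⟩ := hOne
  obtain ⟨V, ⟨hV, hVc⟩, hVO⟩ :=
    ((LocallyConvexSpace.convex_basis (𝕜 := ℝ) x).mem_iff).1 (hO.mem_nhds hx)
  refine ⟨interior V, isOpen_interior, hVc.interior, ⟨x, mem_interior_iff_mem_nhds.2 hV⟩, ?_⟩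
  filter_upwards [hSO] with y hy hy'
  have hyO : y ∈ O := hVO (interior_subset hy'.1)
  exact hy'.2 ((show (y ∈ S) = (y ∈ O) from hy).symm ▸ hyO)

/-- There is no analytic maximal orthogonal family in `P(2^ω)`: any analytic set
of pairwise mutually singular Borel probability measures on Cantor space fails
to be maximal. -/
theorem no_analytic_mof (A : Set (ProbabilityMeasure (ℕ → Bool)))
    (hA : MeasureTheory.AnalyticSet A)
    (horth : ∀ μ ∈ A, ∀ ν ∈ A, μ ≠ ν →
      Measure.MutuallySingular (μ : Measure (ℕ → Bool)) (ν : Measure (ℕ → Bool))) :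
    ∃ ν : ProbabilityMeasure (ℕ → Bool), ν ∉ A ∧ ∀ μ ∈ A,
      Measure.MutuallySingular (ν : Measure (ℕ → Bool)) (μ : Measure (ℕ → Bool)) := by
  by_contra! hno
  have hmax : ∀ ν : ProbabilityMeasure (ℕ → Bool), ∃ μ ∈ A,
      ¬ (ν : Measure (ℕ → Bool)) ⟂ₘ (μ : Measure (ℕ → Bool)) := by
    intro ν
    by_cases hν : ν ∈ A
    · refine ⟨ν, hν, fun h => ?_⟩
      exact IsProbabilityMeasure.ne_zero (ν : Measure (ℕ → Bool))
        ((Measure.MutuallySingular.self_iff _).1 h)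
    · exact hno ν hν
  rw [AnalyticSet] at hA
  obtain rfl | ⟨f, hf, rfl⟩ := hA
  · obtain ⟨μ, hμ, -⟩ := hmax ⟨bernoulliProd 0, inferInstance⟩
    exact hμ
  have hcover : (univ : Set (ℕ → ℝ)) ⊆
      ⋃ d : CylCode × ℕ, selectionDomain f d.1 ((1 / 2) ^ d.2) := by
    intro x _
    obtain ⟨_, ⟨a, rfl⟩, ha⟩ := hmax ⟨bernoulliProd x, inferInstance⟩
    obtain ⟨c, m, h⟩ := exists_mem_selectionDomain
      (fun a b => horth _ ⟨a, rfl⟩ _ ⟨b, rfl⟩) ha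
    exact mem_iUnion.2 ⟨(c, m), h⟩
  obtain ⟨d, hd⟩ : ∃ d : CylCode × ℕ, ¬ IsMeagre (selectionDomain f d.1 ((1 / 2) ^ d.2)) := by
    by_contra! hall
    exact not_isMeagre_of_isOpen isOpen_univ univ_nonempty ((isMeagre_iUnion hall).mono hcover)
  obtain ⟨U, hU, hUc, hUne, hUd⟩ :=
    exists_convex_open_of_not_isMeagre (baireMeasurableSet_selectionDomain hf _) hd
  exact not_isMeagre_diff_selectionDomain hf (by positivity) hU hUc hUne hUd

end
end
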